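/- arXiv:1210.6270 — 4 statements merged into one kernel-verified Lean document; each statement's English description precedes it below -/
import Mathlib

section
/- For every x, y ∈ Ω and i ∈ {1,2}, the partial derivative of H in the first variable satisfies |∂H/∂x_i (x,y)| ≤ 1/(2π·d(x)), where d(x) = dist(x,∂Ω); consequently |∇_x H(x,y)| = O(1/d(x)) uniformly for x, y ∈ Ω. -/
open Real Set Metric Filter MeasureTheory

/-- The Laplacian of a real-valued function on the plane ℝ² ≅ ℂ. -/
noncomputable def planeLap (f : ℂ → ℝ) (x : ℂ) : ℝ :=
  fderiv ℝ (fun y => fderiv ℝ f y 1) x 1 +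
  fderiv ℝ (fun y => fderiv ℝ f y Complex.I) x Complex.I

/-- A function is harmonic on a set if it is C² there with vanishing Laplacian. -/
def HarmonicOnSet (f : ℂ → ℝ) (s : Set ℂ) : Prop :=
  ContDiffOn ℝ 2 f s ∧ ∀ x ∈ s, planeLap f x = 0

/-- `RegPart Ω H`: H is the regular part of the Dirichlet Green's function of −Δ on Ω:
for each x ∈ Ω, y ↦ H(x,y) is harmonic on Ω, extends continuously to the closure of Ω,
with boundary values (1/(2π))·log|x−y| on ∂Ω; moreover H is symmetric on Ω × Ω. -/
def RegPart (Ω : Set ℂ) (H : ℂ → ℂ → ℝ) : Prop :=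
  (∀ x ∈ Ω, HarmonicOnSet (fun y => H x y) Ω ∧
      ContinuousOn (fun y => H x y) (closure Ω) ∧
      ∀ y ∈ frontier Ω, H x y = (1 / (2 * π)) * Real.log ‖x - y‖) ∧
  (∀ x ∈ Ω, ∀ y ∈ Ω, H x y = H y x)

/-- The Green's function G(x,y) = (1/(2π))·log(1/|x−y|) + H(x,y). -/
noncomputable def green (H : ℂ → ℂ → ℝ) (x y : ℂ) : ℝ :=
  (1 / (2 * π)) * Real.log (1 / ‖x - y‖) + H x y

/-- The standard inner product on ℝ² ≅ ℂ. -/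
noncomputable def rinner (z w : ℂ) : ℝ := z.re * w.re + z.im * w.im

open scoped Topology

/-- The second derivative of a continuous function is nonpositive at a local maximum. -/
theorem IsLocalMax.deriv_deriv_nonpos {f : ℝ → ℝ} {a : ℝ} (h : IsLocalMax f a)
    (hf : ContinuousAt f a) : deriv (deriv f) a ≤ 0 := by
  by_contra! hpos
  have hmin := isLocalMin_of_deriv_deriv_pos hpos h.deriv_eq_zero hf
  have hconst : f =ᶠ[𝓝 a] fun _ => f a := by
    filter_upwards [h, hmin] with t h₁ h₂ using le_antisymm h₁ h₂
  simp [hconst.deriv.deriv_eq] at hpos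

/-- A `C²` function has nonpositive second directional derivatives at a local maximum. -/
theorem IsLocalMax.fderiv_fderiv_apply_nonpos {E : Type*} [NormedAddCommGroup E]
    [NormedSpace ℝ E] {g : E → ℝ} {a : E} (h : IsLocalMax g a) (hg : ContDiffAt ℝ 2 g a)
    (v : E) : fderiv ℝ (fun y => fderiv ℝ g y v) a v ≤ 0 := by
  have hline (t : ℝ) : HasDerivAt (fun s : ℝ => a + s • v) v t := by
    simpa using ((hasDerivAt_id t).smul_const v).const_add a
  have hline₀ : Tendsto (fun s : ℝ => a + s • v) (𝓝 0) (𝓝 a) := by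
    simpa using (hline 0).continuousAt.tendsto
  have hderiv : deriv (fun t : ℝ => g (a + t • v)) =ᶠ[𝓝 0]
      fun t => fderiv ℝ g (a + t • v) v := by
    have hdiff : ∀ᶠ y in 𝓝 a, DifferentiableAt ℝ g y :=
      (hg.eventually (by simp)).mono fun y hy => hy.differentiableAt (by simp)
    filter_upwards [hline₀.eventually hdiff] with t ht
    exact (ht.hasFDerivAt.comp_hasDerivAt t (hline t)).deriv
  have hsecond : DifferentiableAt ℝ (fun y => fderiv ℝ g y v) (a + (0 : ℝ) • v) := by
    have : ContDiffAt ℝ 1 (fderiv ℝ g) a := hg.fderiv_right (by norm_num)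
    simpa using (this.differentiableAt (by simp)).clm_apply (differentiableAt_const v)
  have hmax : IsLocalMax (fun t : ℝ => g (a + t • v)) 0 := by
    simpa [IsLocalMax, IsMaxFilter] using hline₀.eventually h
  have hcont : ContinuousAt (fun t : ℝ => g (a + t • v)) 0 := by
    refine ContinuousAt.comp (g := g) ?_ (hline 0).continuousAt
    simpa using hg.continuousAt
  have hle := hmax.deriv_deriv_nonpos hcont
  rw [hderiv.deriv_eq] at hle
  have := (hsecond.hasFDerivAt.comp_hasDerivAt (0 : ℝ) (hline 0)).deriv
  simp only [Function.comp_def, zero_smul, add_zero] at this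
  rwa [this] at hle

theorem planeLap_add {f g : ℂ → ℝ} {a : ℂ} (hf : ContDiffAt ℝ 2 f a)
    (hg : ContDiffAt ℝ 2 g a) :
    planeLap (fun y => f y + g y) a = planeLap f a + planeLap g a := by
  have hev {u : ℂ → ℝ} (hu : ContDiffAt ℝ 2 u a) : ∀ᶠ y in 𝓝 a, DifferentiableAt ℝ u y :=
    (hu.eventually (by simp)).mono fun y hy => hy.differentiableAt (by simp)
  have hdiff {u : ℂ → ℝ} (hu : ContDiffAt ℝ 2 u a) (v : ℂ) :
      DifferentiableAt ℝ (fun y => fderiv ℝ u y v) a := by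
    have : ContDiffAt ℝ 1 (fderiv ℝ u) a := hu.fderiv_right (by norm_num)
    exact (this.differentiableAt (by simp)).clm_apply (differentiableAt_const v)
  have hadd (v : ℂ) : fderiv ℝ (fun y => fderiv ℝ (fun y => f y + g y) y v) a v =
      fderiv ℝ (fun y => fderiv ℝ f y v) a v + fderiv ℝ (fun y => fderiv ℝ g y v) a v := by
    have : (fun y => fderiv ℝ (fun y => f y + g y) y v) =ᶠ[𝓝 a]
        fun y => fderiv ℝ f y v + fderiv ℝ g y v := by
      filter_upwards [hev hf, hev hg] with y h₁ h₂
      rw [fderiv_fun_add h₁ h₂, add_apply]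
    rw [this.fderiv_eq, fderiv_fun_add (hdiff hf v) (hdiff hg v),
      add_apply]
  simp only [planeLap, hadd]
  ring

theorem planeLap_const_mul_re_sq (ε : ℝ) (a : ℂ) :
    planeLap (fun y => ε * y.re ^ 2) a = 2 * ε := by
  have hre (y : ℂ) : HasFDerivAt (fun z : ℂ => z.re) Complex.reCLM y :=
    Complex.reCLM.hasFDerivAt
  have hfirst (y v : ℂ) : fderiv ℝ (fun z : ℂ => ε * z.re ^ 2) y v =
      (2 * ε * v.re) * y.re := by
    rw [(((hre y).pow 2).const_mul ε).fderiv]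
    simp
    ring
  have hsecond (v : ℂ) : fderiv ℝ (fun y : ℂ => (2 * ε * v.re) * y.re) a v =
      (2 * ε * v.re) * v.re := by
    rw [((hre a).const_mul _).fderiv]
    simp
  simp only [planeLap, hfirst, hsecond]
  simp

theorem IsLocalMax.planeLap_nonpos {g : ℂ → ℝ} {a : ℂ} (h : IsLocalMax g a)
    (hg : ContDiffAt ℝ 2 g a) : planeLap g a ≤ 0 :=
  add_nonpos (h.fderiv_fderiv_apply_nonpos hg 1) (h.fderiv_fderiv_apply_nonpos hg Complex.I)

/-- Weak maximum principle for harmonic functions on a bounded open set. -/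
theorem HarmonicOnSet.exists_mem_frontier_le {Ω : Set ℂ} {u : ℂ → ℝ} (hu : HarmonicOnSet u Ω)
    (hΩo : IsOpen Ω) (hΩb : Bornology.IsBounded Ω) (huc : ContinuousOn u (closure Ω))
    {y : ℂ} (hy : y ∈ Ω) {ε : ℝ} (hε : 0 < ε) :
    ∃ z ∈ frontier Ω, u y + ε * y.re ^ 2 ≤ u z + ε * z.re ^ 2 := by
  have hcont : ContinuousOn (fun y : ℂ => u y + ε * y.re ^ 2) (closure Ω) :=
    huc.add (by fun_prop)
  obtain ⟨z, hz, hmax⟩ :=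
    hΩb.isCompact_closure.exists_isMaxOn ⟨y, subset_closure hy⟩ hcont
  refine ⟨z, ?_, hmax (subset_closure hy)⟩
  rw [hΩo.frontier_eq]
  refine ⟨hz, fun hzΩ => ?_⟩
  have hnhds : Ω ∈ 𝓝 z := hΩo.mem_nhds hzΩ
  have hu₂ : ContDiffAt ℝ 2 u z := hu.1.contDiffAt hnhds
  have hq₂ : ContDiffAt ℝ 2 (fun y : ℂ => ε * y.re ^ 2) z := by
    have : ContDiffAt ℝ 2 (fun y : ℂ => y.re) z := Complex.reCLM.contDiff.contDiffAt
    exact contDiffAt_const.mul (this.pow 2)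
  have hle := (hmax.isLocalMax (mem_of_superset hnhds subset_closure)).planeLap_nonpos
    (hu₂.add hq₂)
  rw [planeLap_add hu₂ hq₂, hu.2 z hzΩ, planeLap_const_mul_re_sq] at hle
  linarith

theorem HarmonicOnSet.le_of_le_on_frontier {Ω : Set ℂ} {u : ℂ → ℝ} (hu : HarmonicOnSet u Ω)
    (hΩo : IsOpen Ω) (hΩb : Bornology.IsBounded Ω) (huc : ContinuousOn u (closure Ω)) {M : ℝ}
    (hM : ∀ z ∈ frontier Ω, u z ≤ M) {y : ℂ} (hy : y ∈ Ω) : u y ≤ M := by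
  obtain ⟨R, hR⟩ := hΩb.closure.exists_norm_le
  refine le_of_forall_pos_le_add fun δ hδ => ?_
  have hden : 0 < R ^ 2 + 1 := by positivity
  obtain ⟨z, hz, hle⟩ := hu.exists_mem_frontier_le hΩo hΩb huc hy (div_pos hδ hden)
  have hre : z.re ^ 2 ≤ R ^ 2 + 1 := by
    have h₁ := (Complex.abs_re_le_norm z).trans (hR z (frontier_subset_closure hz))
    nlinarith [sq_abs z.re, abs_nonneg z.re]
  have h₂ : δ / (R ^ 2 + 1) * z.re ^ 2 ≤ δ :=
    (mul_le_mul_of_nonneg_left hre (by positivity)).trans_eq (div_mul_cancel₀ δ hden.ne')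
  have h₃ : 0 ≤ δ / (R ^ 2 + 1) * y.re ^ 2 := by positivity
  linarith [hM z hz]

theorem planeLap_neg (f : ℂ → ℝ) (a : ℂ) : planeLap (fun y => -f y) a = -planeLap f a := by
  simp [planeLap, fderiv_fun_neg]
  ring

theorem HarmonicOnSet.neg {Ω : Set ℂ} {u : ℂ → ℝ} (hu : HarmonicOnSet u Ω) :
    HarmonicOnSet (fun y => -u y) Ω :=
  ⟨hu.1.neg, fun x hx => by rw [planeLap_neg, hu.2 x hx, neg_zero]⟩

theorem HarmonicOnSet.abs_le_of_abs_le_on_frontier {Ω : Set ℂ} {u : ℂ → ℝ}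
    (hu : HarmonicOnSet u Ω) (hΩo : IsOpen Ω) (hΩb : Bornology.IsBounded Ω)
    (huc : ContinuousOn u (closure Ω)) {M : ℝ} (hM : ∀ z ∈ frontier Ω, |u z| ≤ M) {y : ℂ}
    (hy : y ∈ Ω) : |u y| ≤ M :=
  abs_le'.2 ⟨hu.le_of_le_on_frontier hΩo hΩb huc (fun z hz => (abs_le'.1 (hM z hz)).1) hy,
    hu.neg.le_of_le_on_frontier hΩo hΩb huc.neg (fun z hz => (abs_le'.1 (hM z hz)).2) hy⟩

theorem abs_rinner_le_norm (w : ℂ) {v : ℂ} (hv : v ∈ ({1, Complex.I} : Set ℂ)) :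
    |rinner w v| ≤ ‖w‖ := by
  rcases hv with rfl | rfl
  · simpa [rinner] using Complex.abs_re_le_norm w
  · simpa [rinner] using Complex.abs_im_le_norm w

/-- |∂H/∂x_i(x,y)| ≤ 1/(2π d(x)) for x, y ∈ Ω and i = 1,2, where the
partial derivatives of H in the first variable (in the directions 1 and i of ℝ² ≅ ℂ)
are harmonic in y with boundary values (1/(2π))(x_i − y_i)/|x−y|². -/
theorem gradient_regular_part_bound (Ω : Set ℂ) (hΩo : IsOpen Ω) (hΩc : IsConnected Ω)
    (hΩb : Bornology.IsBounded Ω) (H : ℂ → ℂ → ℝ) (hH : RegPart Ω H)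
    (hdiff : ∀ y ∈ Ω, ∀ x ∈ Ω, DifferentiableAt ℝ (fun x' => H x' y) x)
    (hDH : ∀ x ∈ Ω, ∀ v ∈ ({1, Complex.I} : Set ℂ),
      HarmonicOnSet (fun y => fderiv ℝ (fun x' => H x' y) x v) Ω ∧
      ContinuousOn (fun y => fderiv ℝ (fun x' => H x' y) x v) (closure Ω) ∧
      ∀ y ∈ frontier Ω,
        fderiv ℝ (fun x' => H x' y) x v = (1 / (2 * π)) * rinner (x - y) v / ‖x - y‖ ^ 2) :
    ∀ x ∈ Ω, ∀ y ∈ Ω, ∀ v ∈ ({1, Complex.I} : Set ℂ),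
      |fderiv ℝ (fun x' => H x' y) x v| ≤ 1 / (2 * π * Metric.infDist x (frontier Ω)) := by
  intro x hx y hy v hv
  obtain ⟨hharm, hcont, hbdry⟩ := hDH x hx v hv
  refine hharm.abs_le_of_abs_le_on_frontier hΩo hΩb hcont (fun z hz => ?_) hy
  have hxf : x ∉ frontier Ω := fun h => (hΩo.frontier_eq ▸ h).2 hx
  have hpos : 0 < infDist x (frontier Ω) :=
    (isClosed_frontier.notMem_iff_infDist_pos ⟨z, hz⟩).1 hxf
  have hle : infDist x (frontier Ω) ≤ ‖x - z‖ := by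
    simpa [dist_eq_norm] using infDist_le_dist_of_mem (x := x) hz
  have hnorm : 0 < ‖x - z‖ := hpos.trans_le hle
  rw [hbdry z hz, abs_div, abs_mul, abs_of_pos (by positivity : 0 < 1 / (2 * π)),
    abs_of_pos (by positivity : 0 < ‖x - z‖ ^ 2)]
  calc 1 / (2 * π) * |rinner (x - z) v| / ‖x - z‖ ^ 2
      ≤ 1 / (2 * π) * ‖x - z‖ / ‖x - z‖ ^ 2 := by
        gcongr
        exact abs_rinner_le_norm _ hv
    _ = 1 / (2 * π * ‖x - z‖) := by field_simp
    _ ≤ 1 / (2 * π * infDist x (frontier Ω)) := by gcongr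
end

section
/- For every c > 0 there exists C > 0 such that G(x,y) ≤ C for all x, y ∈ Ω with x ≠ y and |x − y| ≥ c·d(x), where d(x) = dist(x,∂Ω). In particular, if x_n, y_n ∈ Ω are sequences with |x_n − y_n| ≥ c·d(x_n) for all n, then the sequence G(x_n, y_n) is bounded. -/
open Real Set Metric Filter MeasureTheory

/-- The collar Ω₀ = {x ∈ Ω : dist(x,∂Ω) < δ₀}. -/
def collar (Ω : Set ℂ) (δ₀ : ℝ) : Set ℂ :=
  {x | x ∈ Ω ∧ Metric.infDist x (frontier Ω) < δ₀}

/-- `Ω has C² boundary`: there are δ₀ > 0 and C₀ > 0 such that the nearest-point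
projection onto ∂Ω is well defined and C¹ on the collar Ω₀, and the inward unit
normal ν satisfies |⟨z − w, ν_w⟩| ≤ C₀|z − w|² for w, z ∈ ∂Ω. -/
structure C2Boundary (Ω : Set ℂ) where
  δ₀ : ℝ
  C₀ : ℝ
  proj : ℂ → ℂ
  ν : ℂ → ℂ
  δ₀_pos : 0 < δ₀
  C₀_pos : 0 < C₀
  proj_mem : ∀ x ∈ collar Ω δ₀, proj x ∈ frontier Ω
  proj_dist : ∀ x ∈ collar Ω δ₀, ‖x - proj x‖ = Metric.infDist x (frontier Ω)
  proj_unique : ∀ x ∈ collar Ω δ₀, ∀ z ∈ frontier Ω,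
    ‖x - z‖ = Metric.infDist x (frontier Ω) → z = proj x
  proj_C1 : ContDiffOn ℝ 1 proj (collar Ω δ₀)
  ν_unit : ∀ w ∈ frontier Ω, ‖ν w‖ = 1
  ν_compat : ∀ x ∈ collar Ω δ₀, ν (proj x) = (‖x - proj x‖)⁻¹ • (x - proj x)
  quad : ∀ w ∈ frontier Ω, ∀ z ∈ frontier Ω, |rinner (z - w) (ν w)| ≤ C₀ * ‖z - w‖ ^ 2

/-- The reflection x̄ = 2p(x) − x of x across ∂Ω. -/
noncomputable def C2Boundary.refl {Ω : Set ℂ} (b : C2Boundary Ω) (x : ℂ) : ℂ :=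
  2 * b.proj x - x

/-- The inward unit normal ν_x = (x − p(x))/|x − p(x)| at p(x). -/
noncomputable def C2Boundary.nuAt {Ω : Set ℂ} (b : C2Boundary Ω) (x : ℂ) : ℂ :=
  (‖x - b.proj x‖)⁻¹ • (x - b.proj x)

/-- The squared Euclidean distance to the point `e`, in coordinates. -/
noncomputable def sqDist (e y : ℂ) : ℝ := (y.re - e.re) ^ 2 + (y.im - e.im) ^ 2

lemma sqDist_eq (e y : ℂ) : sqDist e y = ‖e - y‖ ^ 2 := by
  rw [← Complex.normSq_eq_norm_sq, Complex.normSq_apply, sqDist]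
  simp only [Complex.sub_re, Complex.sub_im]
  ring

lemma sqDist_nonneg (e y : ℂ) : 0 ≤ sqDist e y := by
  rw [sqDist_eq]; positivity

lemma contDiff_sqDist (e : ℂ) : ContDiff ℝ 2 (sqDist e) := by
  have hr : ContDiff ℝ 2 (fun y : ℂ => y.re) := Complex.reCLM.contDiff
  have hi : ContDiff ℝ 2 (fun y : ℂ => y.im) := Complex.imCLM.contDiff
  exact ((hr.sub contDiff_const).pow 2).add ((hi.sub contDiff_const).pow 2)

lemma hasFDerivAt_sqDist (e y : ℂ) :
    HasFDerivAt (sqDist e)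
      ((2 * (y.re - e.re)) • Complex.reCLM + (2 * (y.im - e.im)) • Complex.imCLM) y := by
  have hr : HasFDerivAt (fun y : ℂ => y.re) Complex.reCLM y := Complex.reCLM.hasFDerivAt
  have hi : HasFDerivAt (fun y : ℂ => y.im) Complex.imCLM y := Complex.imCLM.hasFDerivAt
  have h := ((hr.sub_const e.re).pow 2).add ((hi.sub_const e.im).pow 2)
  refine h.congr_fderiv ?_
  ext
  simp

lemma planeLap_sqDist (e x : ℂ) : planeLap (sqDist e) x = 4 := by
  have h1 : (fun y => fderiv ℝ (sqDist e) y 1) = fun y => 2 * (y.re - e.re) := by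
    funext y; rw [(hasFDerivAt_sqDist e y).fderiv]; simp
  have h2 : (fun y => fderiv ℝ (sqDist e) y Complex.I) = fun y => 2 * (y.im - e.im) := by
    funext y; rw [(hasFDerivAt_sqDist e y).fderiv]; simp
  have hr : HasFDerivAt (fun y : ℂ => y.re) Complex.reCLM x := Complex.reCLM.hasFDerivAt
  have hi : HasFDerivAt (fun y : ℂ => y.im) Complex.imCLM x := Complex.imCLM.hasFDerivAt
  rw [planeLap, h1, h2, ((hr.sub_const e.re).const_mul 2).fderiv,
    ((hi.sub_const e.im).const_mul 2).fderiv]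
  simp
  norm_num

lemma contDiffAt_log_sqDist {e x : ℂ} {s : ℝ} (h : sqDist e x + s ≠ 0) :
    ContDiffAt ℝ 2 (fun y => Real.log (sqDist e y + s)) x :=
  ((contDiff_sqDist e).contDiffAt.add contDiffAt_const).log h

lemma planeLap_log_sqDist {e x : ℂ} {s : ℝ} (h : sqDist e x + s ≠ 0) :
    planeLap (fun y => Real.log (sqDist e y + s)) x = 4 * s / (sqDist e x + s) ^ 2 := by
  have hd : ∀ v : ℂ, (fun y => fderiv ℝ (fun y => Real.log (sqDist e y + s)) y v) =ᶠ[nhds x]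
      fun y => (2 * (y.re - e.re) * v.re + 2 * (y.im - e.im) * v.im) * (sqDist e y + s)⁻¹ := by
    intro v
    have hc : ContinuousAt (fun y => sqDist e y + s) x :=
      ((contDiff_sqDist e).continuous.add continuous_const).continuousAt
    filter_upwards [hc.eventually_ne h] with y hy
    rw [(((hasFDerivAt_sqDist e y).add_const s).log hy).fderiv]
    simp
    ring
  have hr : HasFDerivAt (fun y : ℂ => y.re) Complex.reCLM x := Complex.reCLM.hasFDerivAt
  have hi : HasFDerivAt (fun y : ℂ => y.im) Complex.imCLM x := Complex.imCLM.hasFDerivAt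
  have hq : HasFDerivAt (fun y => (sqDist e y + s)⁻¹) _ x :=
    (hasDerivAt_inv h).comp_hasFDerivAt x ((hasFDerivAt_sqDist e x).add_const s)
  have hn : ∀ v : ℂ, HasFDerivAt
      (fun y : ℂ => 2 * (y.re - e.re) * v.re + 2 * (y.im - e.im) * v.im) _ x := fun v =>
    (((hr.sub_const e.re).const_mul 2).mul_const v.re).add
      (((hi.sub_const e.im).const_mul 2).mul_const v.im)
  rw [planeLap, (hd 1).fderiv_eq, (hd Complex.I).fderiv_eq, ((hn 1).fun_mul hq).fderiv,
    ((hn Complex.I).fun_mul hq).fderiv]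
  simp
  field_simp
  simp only [sqDist]
  ring

lemma ContDiffAt.differentiableAt_fderiv_apply {f : ℂ → ℝ} {x : ℂ} (hf : ContDiffAt ℝ 2 f x)
    (v : ℂ) : DifferentiableAt ℝ (fun y => fderiv ℝ f y v) x := by
  have h : ContDiffAt ℝ 1 (fderiv ℝ f) x := hf.fderiv_right (by norm_num)
  exact (h.differentiableAt (by norm_num)).clm_apply (differentiableAt_const v)

lemma planeLap_add_const_mul {f g : ℂ → ℝ} {x : ℂ} (hf : ContDiffAt ℝ 2 f x)
    (hg : ContDiffAt ℝ 2 g x) (a b : ℝ) :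
    planeLap (fun y => a * f y + b * g y) x = a * planeLap f x + b * planeLap g x := by
  have hd : ∀ v : ℂ, (fun y => fderiv ℝ (fun y => a * f y + b * g y) y v) =ᶠ[nhds x]
      fun y => a * fderiv ℝ f y v + b * fderiv ℝ g y v := by
    intro v
    filter_upwards [hf.eventually (by simp), hg.eventually (by simp)] with y hfy hgy
    have h1 := (hfy.differentiableAt (by norm_num)).hasFDerivAt
    have h2 := (hgy.differentiableAt (by norm_num)).hasFDerivAt
    rw [((h1.const_mul a).fun_add (h2.const_mul b)).fderiv]
    simp
  have hs : ∀ v : ℂ, fderiv ℝ (fun y => a * fderiv ℝ f y v + b * fderiv ℝ g y v) x v =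
      a * fderiv ℝ (fun y => fderiv ℝ f y v) x v + b * fderiv ℝ (fun y => fderiv ℝ g y v) x v := by
    intro v
    have h1 := (hf.differentiableAt_fderiv_apply v).hasFDerivAt
    have h2 := (hg.differentiableAt_fderiv_apply v).hasFDerivAt
    rw [((h1.const_mul a).fun_add (h2.const_mul b)).fderiv]
    simp
  rw [planeLap, (hd 1).fderiv_eq, (hd Complex.I).fderiv_eq, hs, hs, planeLap, planeLap]
  ring

lemma IsLocalMax.fderiv_fderiv_apply_nonpos_s15 {f : ℂ → ℝ} {x : ℂ} (hm : IsLocalMax f x)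
    (hf : ContDiffAt ℝ 2 f x) (v : ℂ) : fderiv ℝ (fun y => fderiv ℝ f y v) x v ≤ 0 := by
  have hline : ∀ t : ℝ, HasDerivAt (fun t : ℝ => x + (t : ℂ) * v) v t := fun t => by
    simpa using ((Complex.ofRealCLM.hasDerivAt (x := t)).mul_const v).const_add x
  have hcont : Tendsto (fun t : ℝ => x + (t : ℂ) * v) (nhds 0) (nhds x) := by
    simpa using (hline 0).continuousAt.tendsto
  have hd : deriv (fun t : ℝ => f (x + (t : ℂ) * v)) =ᶠ[nhds 0]
      fun t : ℝ => fderiv ℝ f (x + (t : ℂ) * v) v := by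
    filter_upwards [hcont.eventually (hf.eventually (by simp))] with t ht
    exact ((ht.differentiableAt (by norm_num)).hasFDerivAt.comp_hasDerivAt t (hline t)).deriv
  have hdd : deriv (deriv (fun t : ℝ => f (x + (t : ℂ) * v))) 0 =
      fderiv ℝ (fun y => fderiv ℝ f y v) x v := by
    rw [hd.deriv_eq]
    have h := (hf.differentiableAt_fderiv_apply v).hasFDerivAt
    exact (h.comp_hasDerivAt_of_eq (0 : ℝ) (hline 0) (by simp)).deriv
  have hmax : IsLocalMax (fun t : ℝ => f (x + (t : ℂ) * v)) 0 := by
    have := hcont.eventually hm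
    simpa [IsLocalMax, IsMaxFilter] using this
  by_contra! hpos
  rw [← hdd] at hpos
  have hc : ContinuousAt (fun t : ℝ => f (x + (t : ℂ) * v)) 0 := by
    have : ContinuousAt f (x + ((0 : ℝ) : ℂ) * v) := by simpa using hf.continuousAt
    exact ContinuousAt.comp (f := fun t : ℝ => x + (t : ℂ) * v) this (hline 0).continuousAt
  have hmin := isLocalMin_of_deriv_deriv_pos hpos hmax.deriv_eq_zero hc
  have hconst : (fun t : ℝ => f (x + (t : ℂ) * v)) =ᶠ[nhds 0] fun _ => f (x + ((0 : ℝ) : ℂ) * v) := by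
    filter_upwards [hmax, hmin] with t h1 h2
    exact le_antisymm h1 h2
  have h0 : deriv (deriv (fun t : ℝ => f (x + (t : ℂ) * v))) 0 = 0 := by
    rw [hconst.deriv.deriv_eq]
    simp
  exact hpos.ne' h0

lemma IsLocalMax.planeLap_nonpos_s15 {f : ℂ → ℝ} {x : ℂ} (hm : IsLocalMax f x)
    (hf : ContDiffAt ℝ 2 f x) : planeLap f x ≤ 0 :=
  add_nonpos (hm.fderiv_fderiv_apply_nonpos_s15 hf 1) (hm.fderiv_fderiv_apply_nonpos_s15 hf Complex.I)

/-- The weak maximum principle for C² subharmonic functions on a bounded open set. -/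
lemma le_of_planeLap_nonneg {Ω : Set ℂ} (ho : IsOpen Ω) (hb : Bornology.IsBounded Ω)
    {u : ℂ → ℝ} (hc : ContinuousOn u (closure Ω)) (hu : ∀ x ∈ Ω, ContDiffAt ℝ 2 u x)
    (hl : ∀ x ∈ Ω, 0 ≤ planeLap u x) {M : ℝ} (hM : ∀ z ∈ frontier Ω, u z ≤ M)
    {y : ℂ} (hy : y ∈ Ω) : u y ≤ M := by
  by_contra! hlt
  obtain ⟨R, hR⟩ := hb.closure.exists_norm_le
  set ε := (u y - M) / (R ^ 2 + 1) with hε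
  have hε0 : 0 < ε := div_pos (by linarith) (by positivity)
  have hεR : ε * R ^ 2 < u y - M := by
    have : ε * (R ^ 2 + 1) = u y - M := by rw [hε]; field_simp
    linarith
  have hvc : ContinuousOn (fun y => 1 * u y + ε * sqDist 0 y) (closure Ω) :=
    (continuousOn_const.mul hc).add
      (continuousOn_const.mul (contDiff_sqDist 0).continuous.continuousOn)
  obtain ⟨p, hp, hpmax⟩ := hb.isCompact_closure.exists_isMaxOn ⟨y, subset_closure hy⟩ hvc
  have hpy : 1 * u y + ε * sqDist 0 y ≤ 1 * u p + ε * sqDist 0 p := hpmax (subset_closure hy)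
  have hpΩ : p ∈ Ω := by
    by_contra hpn
    have h1 := hM p ⟨hp, by rwa [ho.interior_eq]⟩
    have h2 : sqDist 0 p ≤ R ^ 2 := by
      rw [sqDist_eq, zero_sub, norm_neg]
      exact pow_le_pow_left₀ (norm_nonneg _) (hR p hp) 2
    have h3 := mul_le_mul_of_nonneg_left h2 hε0.le
    have h4 := mul_nonneg hε0.le (sqDist_nonneg 0 y)
    linarith
  have hloc : IsLocalMax (fun y => 1 * u y + ε * sqDist 0 y) p :=
    (hpmax.on_subset subset_closure).isLocalMax (ho.mem_nhds hpΩ)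
  have hs : ContDiffAt ℝ 2 (sqDist 0) p := (contDiff_sqDist 0).contDiffAt
  have h := hloc.planeLap_nonpos_s15
    ((contDiffAt_const.mul (hu p hpΩ)).add (contDiffAt_const.mul hs))
  rw [planeLap_add_const_mul (hu p hpΩ) hs, planeLap_sqDist] at h
  linarith [hl p hpΩ]

/-- If `a * h + b * log (|e - ·|² + s)` is subharmonic on `Ω`, it is bounded by its boundary
values. -/
lemma HarmonicOnSet.add_log_le {Ω : Set ℂ} (ho : IsOpen Ω) (hb : Bornology.IsBounded Ω)
    {h : ℂ → ℝ} (hh : HarmonicOnSet h Ω) (hc : ContinuousOn h (closure Ω)) {e : ℂ} {s : ℝ}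
    (hpos : ∀ y ∈ closure Ω, sqDist e y + s ≠ 0) {a b : ℝ}
    (hbs : 0 ≤ b * s) {M : ℝ}
    (hM : ∀ z ∈ frontier Ω, a * h z + b * Real.log (sqDist e z + s) ≤ M) {y : ℂ} (hy : y ∈ Ω) :
    a * h y + b * Real.log (sqDist e y + s) ≤ M := by
  have hhc : ∀ x ∈ Ω, ContDiffAt ℝ 2 h x := fun x hx => hh.1.contDiffAt (ho.mem_nhds hx)
  have hlc : ∀ x ∈ closure Ω, ContDiffAt ℝ 2 (fun y => Real.log (sqDist e y + s)) x :=
    fun x hx => contDiffAt_log_sqDist (hpos x hx)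
  refine le_of_planeLap_nonneg (u := fun y => a * h y + b * Real.log (sqDist e y + s)) ho hb
    ?_ ?_ ?_ hM hy
  · exact (continuousOn_const.mul hc).add
      (continuousOn_const.mul fun x hx => (hlc x hx).continuousAt.continuousWithinAt)
  · exact fun x hx => (contDiffAt_const.mul (hhc x hx)).add
      (contDiffAt_const.mul (hlc x (subset_closure hx)))
  · intro x hx
    rw [planeLap_add_const_mul (hhc x hx) (hlc x (subset_closure hx)), hh.2 x hx,
      planeLap_log_sqDist (hpos x (subset_closure hx)), mul_zero, zero_add,
      show b * (4 * s / (sqDist e x + s) ^ 2) = 4 * (b * s) / (sqDist e x + s) ^ 2 by ring]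
    positivity

lemma frontier_nonempty_of_isBounded {Ω : Set ℂ} (hb : Bornology.IsBounded Ω)
    (hne : Ω.Nonempty) : (frontier Ω).Nonempty := by
  rw [nonempty_frontier_iff]
  refine ⟨hne, fun h => ?_⟩
  rw [h] at hb
  exact NormedSpace.unbounded_univ ℝ ℂ hb

lemma infDist_frontier_pos {Ω : Set ℂ} (ho : IsOpen Ω) (hb : Bornology.IsBounded Ω) {x : ℂ}
    (hx : x ∈ Ω) : 0 < infDist x (frontier Ω) := by
  refine (isClosed_frontier.notMem_iff_infDist_pos
    (frontier_nonempty_of_isBounded hb ⟨x, hx⟩)).1 fun h => ?_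
  exact h.2 (by rwa [ho.interior_eq])

lemma infDist_le_norm_sub {Ω : Set ℂ} {x z : ℂ} (hz : z ∈ frontier Ω) :
    infDist x (frontier Ω) ≤ ‖x - z‖ := by
  rw [← dist_eq_norm]; exact infDist_le_dist_of_mem hz

lemma green_eq (H : ℂ → ℂ → ℝ) (x y : ℂ) :
    green H x y = H x y - (1 / (2 * π)) * Real.log ‖x - y‖ := by
  rw [green, one_div ‖x - y‖, Real.log_inv]; ring

/-- Comparison of the regular part with the logarithm centred at an exterior point. -/
lemma green_le_of_exterior_point {Ω : Set ℂ} (ho : IsOpen Ω) (hb : Bornology.IsBounded Ω)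
    {H : ℂ → ℂ → ℝ} (hH : RegPart Ω H) {x e : ℂ} (hx : x ∈ Ω) (he : e ∉ closure Ω)
    {K : ℝ} (hK : 0 < K) (hKe : ∀ z ∈ frontier Ω, ‖x - z‖ ≤ K * ‖e - z‖) {y : ℂ} (hy : y ∈ Ω)
    (hxy : x ≠ y) {L : ℝ} (hL : ‖e - y‖ ≤ L * ‖x - y‖) :
    green H x y ≤ (1 / (2 * π)) * Real.log (K * L) := by
  have hπ : 0 < 1 / (2 * π) := by positivity
  have hey : ∀ y ∈ closure Ω, 0 < ‖e - y‖ := fun y hy =>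
    norm_pos_iff.2 (sub_ne_zero.2 fun h => he (h ▸ hy))
  have hlog : ∀ y, Real.log (sqDist e y + 0) = 2 * Real.log ‖e - y‖ := fun y => by
    rw [add_zero, sqDist_eq, Real.log_pow]; norm_num
  obtain ⟨hh, hc, hbd⟩ := hH.1 x hx
  have key := hh.add_log_le ho hb hc (e := e) (s := 0) (a := 1) (b := -(1 / (2 * π)) / 2)
    (M := (1 / (2 * π)) * Real.log K)
    (fun y hy => by rw [add_zero, sqDist_eq]; exact (pow_pos (hey y hy) 2).ne') (by simp)
    (fun z hz => by
      have hxz : 0 < ‖x - z‖ := (infDist_frontier_pos ho hb hx).trans_le (infDist_le_norm_sub hz)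
      have h := Real.log_le_log hxz (hKe z hz)
      rw [Real.log_mul hK.ne' (hey z hz.1).ne'] at h
      have h' := mul_le_mul_of_nonneg_left h hπ.le
      simp only [hlog, hbd z hz]
      linarith) hy
  have hxy' : 0 < ‖x - y‖ := norm_pos_iff.2 (sub_ne_zero.2 hxy)
  have hLpos : 0 < L := pos_of_mul_pos_left ((hey y (subset_closure hy)).trans_le hL) hxy'.le
  have h := Real.log_le_log (hey y (subset_closure hy)) hL
  rw [Real.log_mul hLpos.ne' hxy'.ne'] at h
  have h' := mul_le_mul_of_nonneg_left h hπ.le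
  simp only [hlog] at key
  rw [green_eq, Real.log_mul hK.ne' hLpos.ne']
  linarith

lemma neg_log_two_le_green {Ω : Set ℂ} (ho : IsOpen Ω) (hb : Bornology.IsBounded Ω)
    {H : ℂ → ℂ → ℝ} (hH : RegPart Ω H) {x y : ℂ} (hx : x ∈ Ω) (hy : y ∈ Ω) (hxy : x ≠ y) :
    -((1 / (2 * π)) / 2 * Real.log 2) ≤ green H x y := by
  have hπ : 0 < (1 / (2 * π)) / 2 := by positivity
  have hd := infDist_frontier_pos ho hb hx
  set d := infDist x (frontier Ω)
  have hlog : ∀ y, Real.log (sqDist x y) = 2 * Real.log ‖x - y‖ := fun y => by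
    rw [sqDist_eq, Real.log_pow]; norm_num
  obtain ⟨hh, hc, hbd⟩ := hH.1 x hx
  have hpos : ∀ y, 0 < sqDist x y + d ^ 2 := fun y =>
    add_pos_of_nonneg_of_pos (sqDist_nonneg x y) (pow_pos hd 2)
  have key := hh.add_log_le ho hb hc (e := x) (s := d ^ 2) (a := -1) (b := (1 / (2 * π)) / 2)
    (M := (1 / (2 * π)) / 2 * Real.log 2) (fun y _ => (hpos y).ne') (by positivity)
    (fun z hz => by
      have hdz : d ≤ ‖x - z‖ := infDist_le_norm_sub hz
      have hsz : 0 < sqDist x z := by rw [sqDist_eq]; exact pow_pos (hd.trans_le hdz) 2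
      have hle : sqDist x z + d ^ 2 ≤ 2 * sqDist x z := by
        rw [sqDist_eq]; linarith [pow_le_pow_left₀ hd.le hdz 2]
      have h := Real.log_le_log (hpos z) hle
      rw [Real.log_mul two_ne_zero hsz.ne', hlog] at h
      have h' := mul_le_mul_of_nonneg_left h hπ.le
      simp only [hbd z hz]
      linarith) hy
  have hsy : 0 < sqDist x y := by
    rw [sqDist_eq]; exact pow_pos (norm_pos_iff.2 (sub_ne_zero.2 hxy)) 2
  have h := Real.log_le_log hsy (le_add_of_nonneg_right (sq_nonneg d))
  rw [hlog] at h
  have h' := mul_le_mul_of_nonneg_left h hπ.le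
  rw [green_eq]
  linarith

lemma C2Boundary.infDist_le_norm_refl_sub {Ω : Set ℂ} (b : C2Boundary Ω) {x : ℂ}
    (hx : x ∈ collar Ω b.δ₀) (hd0 : 0 < infDist x (frontier Ω))
    (hd : 2 * b.C₀ * infDist x (frontier Ω) ≤ 1) {z : ℂ} (hz : z ∈ frontier Ω) :
    infDist x (frontier Ω) ≤ ‖b.refl x - z‖ := by
  have hw := b.proj_mem x hx
  have hq := b.quad _ hw z hz
  have hdist := b.proj_dist x hx
  rw [b.ν_compat x hx, hdist] at hq
  set d := infDist x (frontier Ω)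
  set w := b.proj x
  have hr : rinner (z - w) (d⁻¹ • (x - w)) = d⁻¹ * rinner (z - w) (x - w) := by
    simp only [rinner, Complex.smul_re, Complex.smul_im, smul_eq_mul]; ring
  rw [hr, abs_mul, abs_of_pos (inv_pos.2 hd0), inv_mul_le_iff₀ hd0] at hq
  have hexp : ‖b.refl x - z‖ ^ 2 = ‖z - w‖ ^ 2 + 2 * rinner (z - w) (x - w) + ‖x - w‖ ^ 2 := by
    simp only [← Complex.normSq_eq_norm_sq, Complex.normSq_apply, rinner, C2Boundary.refl]
    simp
    ring
  refine le_of_sq_le_sq ?_ (norm_nonneg _)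
  rw [hexp, hdist]
  have h1 := neg_abs_le (rinner (z - w) (x - w))
  have h2 := mul_le_mul_of_nonneg_right hd (sq_nonneg ‖z - w‖)
  nlinarith

lemma C2Boundary.refl_notMem_closure {Ω : Set ℂ} (ho : IsOpen Ω) (b : C2Boundary Ω) {x : ℂ}
    (hx : x ∈ collar Ω b.δ₀) (hd0 : 0 < infDist x (frontier Ω))
    (hd : 2 * b.C₀ * infDist x (frontier Ω) ≤ 1) : b.refl x ∉ closure Ω := by
  intro hcl
  have hle : ∀ z ∈ frontier Ω, infDist x (frontier Ω) ≤ ‖b.refl x - z‖ :=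
    fun z hz => b.infDist_le_norm_refl_sub hx hd0 hd hz
  have hmem : b.refl x ∈ Ω := by
    by_contra hn
    have := hle _ ⟨hcl, by rwa [ho.interior_eq]⟩
    simp at this
    linarith
  have hw := b.proj_mem x hx
  have hsub : b.refl x - b.proj x = -(x - b.proj x) := by rw [C2Boundary.refl]; ring
  have hnorm : ‖b.refl x - b.proj x‖ = infDist x (frontier Ω) := by
    rw [hsub, norm_neg, b.proj_dist x hx]
  have hinf : infDist (b.refl x) (frontier Ω) = infDist x (frontier Ω) := by
    refine le_antisymm (hnorm ▸ infDist_le_norm_sub hw) ?_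
    exact (le_infDist ⟨_, hw⟩).2 fun {z} hz => by rw [dist_eq_norm]; exact hle z hz
  have hcol : b.refl x ∈ collar Ω b.δ₀ := ⟨hmem, hinf ▸ hx.2⟩
  have hp := b.proj_unique _ hcol _ hw (by rw [hnorm, hinf])
  have h1 := b.ν_compat _ hcol
  rw [← hp, b.ν_compat x hx, hsub, norm_neg, smul_neg, b.proj_dist x hx] at h1
  have h2 := self_eq_neg.1 h1
  rw [smul_eq_zero] at h2
  rcases h2 with h2 | h2
  · exact (inv_pos.2 hd0).ne' h2
  · have := b.proj_dist x hx
    rw [h2, norm_zero] at this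
    exact hd0.ne this

/-- Every point of `Ω` has an exterior companion whose distance to the boundary is comparable. -/
lemma C2Boundary.exists_exterior_point {Ω : Set ℂ} (ho : IsOpen Ω)
    (hb : Bornology.IsBounded Ω) (b : C2Boundary Ω) :
    ∃ A > 0, ∀ x ∈ Ω, ∃ e, e ∉ closure Ω ∧ (∀ z ∈ frontier Ω, ‖x - z‖ ≤ 3 * ‖e - z‖) ∧
      ‖e - x‖ ≤ A * infDist x (frontier Ω) := by
  obtain ⟨R, hR0, hR⟩ := hb.closure.exists_pos_norm_le
  have hC := b.C₀_pos
  set r := min b.δ₀ (1 / (2 * b.C₀)) with hr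
  have hr0 : 0 < r := lt_min b.δ₀_pos (by positivity)
  refine ⟨max 2 (4 * R / r), by positivity, fun x hx => ?_⟩
  have hd0 := infDist_frontier_pos ho hb hx
  rcases lt_or_ge (infDist x (frontier Ω)) r with hlt | hge
  · have hcol : x ∈ collar Ω b.δ₀ := ⟨hx, hlt.trans_le (min_le_left _ _)⟩
    have hd : 2 * b.C₀ * infDist x (frontier Ω) ≤ 1 := by
      have := (hlt.trans_le (min_le_right _ _)).le
      rwa [le_div_iff₀ (by positivity), mul_comm] at this
    have hnorm : ‖b.refl x - x‖ = 2 * infDist x (frontier Ω) := by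
      rw [← b.proj_dist x hcol, show b.refl x - x = (-2 : ℝ) • (x - b.proj x) by
        rw [C2Boundary.refl, Complex.real_smul]; push_cast; ring, norm_smul]
      norm_num
    refine ⟨b.refl x, b.refl_notMem_closure ho hcol hd0 hd, fun z hz => ?_, ?_⟩
    · have h1 := b.infDist_le_norm_refl_sub hcol hd0 hd hz
      have h2 := norm_sub_le_norm_sub_add_norm_sub x (b.refl x) z
      rw [norm_sub_rev x (b.refl x)] at h2
      linarith
    · rw [hnorm]
      exact mul_le_mul_of_nonneg_right (le_max_left _ _) hd0.le
  · have he : ‖((3 * R : ℝ) : ℂ)‖ = 3 * R := by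
      rw [Complex.norm_real, Real.norm_of_nonneg (by positivity)]
    have hxR := hR x (subset_closure hx)
    refine ⟨((3 * R : ℝ) : ℂ), fun h => ?_, fun z hz => ?_, ?_⟩
    · have := hR _ h
      linarith
    · have h1 := norm_sub_le x z
      have h2 := norm_sub_norm_le ((3 * R : ℝ) : ℂ) z
      have h3 := hR z hz.1
      linarith
    · have h1 := norm_sub_le ((3 * R : ℝ) : ℂ) x
      calc _ ≤ 4 * R := by linarith
        _ = 4 * R / r * r := by field_simp
        _ ≤ _ := mul_le_mul (le_max_right _ _) hge hr0.le (by positivity)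

/-- for every c > 0 the Green's function is bounded above on pairs with
|x − y| ≥ c·d(x); in particular G(x_n,y_n) is bounded along such sequences. -/
theorem green_bounded_away_from_diagonal (Ω : Set ℂ) (hΩo : IsOpen Ω) (hΩc : IsConnected Ω)
    (hΩb : Bornology.IsBounded Ω) (b : C2Boundary Ω) (H : ℂ → ℂ → ℝ) (hH : RegPart Ω H) :
    ∀ c > (0 : ℝ), ∃ C > 0,
      (∀ x ∈ Ω, ∀ y ∈ Ω, x ≠ y →
          c * Metric.infDist x (frontier Ω) ≤ ‖x - y‖ → green H x y ≤ C) ∧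
      ∀ xs ys : ℕ → ℂ, (∀ n, xs n ∈ Ω) → (∀ n, ys n ∈ Ω) →
        (∀ n, c * Metric.infDist (xs n) (frontier Ω) ≤ ‖xs n - ys n‖) →
        ∃ C' : ℝ, ∀ n, |green H (xs n) (ys n)| ≤ C' := by
  intro c hc
  obtain ⟨A, hA, hext⟩ := b.exists_exterior_point hΩo hΩb
  have hup : ∀ x ∈ Ω, ∀ y ∈ Ω, x ≠ y → c * Metric.infDist x (frontier Ω) ≤ ‖x - y‖ →
      green H x y ≤ (1 / (2 * π)) * Real.log (3 * (1 + A / c)) := by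
    intro x hx y hy hxy hcd
    obtain ⟨e, he, hKe, hex⟩ := hext x hx
    refine green_le_of_exterior_point hΩo hΩb hH hx he three_pos hKe hy hxy ?_
    have h1 := norm_sub_le_norm_sub_add_norm_sub e x y
    have h2 : A * Metric.infDist x (frontier Ω) ≤ A / c * ‖x - y‖ := by
      calc _ = A / c * (c * Metric.infDist x (frontier Ω)) := by field_simp
        _ ≤ _ := mul_le_mul_of_nonneg_left hcd (by positivity)
    linarith
  have hlog : 0 < Real.log (3 * (1 + A / c)) := by
    have : 0 < A / c := by positivity
    exact Real.log_pos (by linarith)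
  refine ⟨(1 / (2 * π)) * Real.log (3 * (1 + A / c)), by positivity, hup,
    fun xs ys hxs hys hcd => ?_⟩
  refine ⟨max ((1 / (2 * π)) * Real.log (3 * (1 + A / c))) ((1 / (2 * π)) / 2 * Real.log 2),
    fun n => ?_⟩
  have hne : xs n ≠ ys n := by
    intro h
    have h1 := hcd n
    rw [h, sub_self, norm_zero] at h1
    exact h1.not_gt (mul_pos hc (infDist_frontier_pos hΩo hΩb (hys n)))
  exact abs_le.2 ⟨(neg_le_neg (le_max_right _ _)).trans
    (neg_log_two_le_green hΩo hΩb hH (hxs n) (hys n) hne),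
    (hup _ (hxs n) _ (hys n) hne (hcd n)).trans (le_max_left _ _)⟩
end

section
/- There exist δ₁ ∈ (0, δ₀] and constants 0 < c ≤ C such that c·|x̄ − y| ≤ |x − y| ≤ C·|x̄ − y| for every x ∈ Ω with d(x) < δ₁ and every y ∈ ∂Ω. Moreover the quantitative estimate | |x − y|² − |x̄ − y|² | ≤ C·d(x)·min{ |x − y|², |x̄ − y|² } holds for such x and y. -/
open Real Set Metric Filter
/-- Reflecting across `p` changes the squared distance to `y` by four times the inner product of
`p - y` with `x - p`. -/
lemma sq_norm_sub_sub_sq_norm_reflection_sub (x p y : ℂ) :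
    ‖x - y‖ ^ 2 - ‖2 * p - x - y‖ ^ 2 = -4 * rinner (y - p) (x - p) := by
  simp only [Complex.sq_norm, Complex.normSq_apply, rinner, Complex.sub_re, Complex.sub_im,
    Complex.mul_re, Complex.mul_im, Complex.re_ofNat, Complex.im_ofNat]
  ring

lemma rinner_smul_right (z w : ℂ) (r : ℝ) : rinner z (r • w) = r * rinner z w := by
  simp only [rinner, Complex.smul_re, Complex.smul_im, smul_eq_mul]
  ring

/-- The nearest-point projection satisfies `|y - p(x)| ≤ 2 |x - y|` for boundary points `y`. -/
lemma C2Boundary.norm_sub_proj_le {Ω : Set ℂ} (b : C2Boundary Ω) {x y : ℂ}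
    (hx : x ∈ collar Ω b.δ₀) (hy : y ∈ frontier Ω) : ‖y - b.proj x‖ ≤ 2 * ‖x - y‖ := by
  have h₁ : ‖x - b.proj x‖ ≤ ‖x - y‖ := by
    rw [b.proj_dist x hx, ← dist_eq_norm]
    exact Metric.infDist_le_dist_of_mem hy
  have h₂ := norm_sub_le_norm_sub_add_norm_sub y x (b.proj x)
  rw [norm_sub_rev y x] at h₂
  linarith

/-- The normal component of `y - p(x)` is quadratically small. -/
lemma C2Boundary.abs_rinner_sub_proj_le {Ω : Set ℂ} (b : C2Boundary Ω) {x y : ℂ}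
    (hx : x ∈ collar Ω b.δ₀) (hy : y ∈ frontier Ω) :
    |rinner (y - b.proj x) (x - b.proj x)| ≤
      Metric.infDist x (frontier Ω) * (b.C₀ * ‖y - b.proj x‖ ^ 2) := by
  have hν : x - b.proj x = Metric.infDist x (frontier Ω) • b.ν (b.proj x) := by
    rw [b.ν_compat x hx, ← b.proj_dist x hx]
    rcases eq_or_ne (x - b.proj x) 0 with h | h
    · simp [h]
    · rw [smul_inv_smul₀ (norm_ne_zero_iff.mpr h)]
  rw [congrArg (rinner (y - b.proj x)) hν, rinner_smul_right, abs_mul,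
    abs_of_nonneg Metric.infDist_nonneg]
  exact mul_le_mul_of_nonneg_left (b.quad _ (b.proj_mem x hx) _ hy) Metric.infDist_nonneg

lemma C2Boundary.abs_sq_norm_sub_sub_le {Ω : Set ℂ} (b : C2Boundary Ω) {x y : ℂ}
    (hx : x ∈ collar Ω b.δ₀) (hy : y ∈ frontier Ω) :
    |‖x - y‖ ^ 2 - ‖b.refl x - y‖ ^ 2| ≤
      16 * b.C₀ * Metric.infDist x (frontier Ω) * ‖x - y‖ ^ 2 := by
  have hd : 0 ≤ Metric.infDist x (frontier Ω) := Metric.infDist_nonneg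
  have hC := b.C₀_pos.le
  rw [C2Boundary.refl, sq_norm_sub_sub_sq_norm_reflection_sub, abs_mul]
  calc |(-4 : ℝ)| * |rinner (y - b.proj x) (x - b.proj x)|
      ≤ 4 * (Metric.infDist x (frontier Ω) * (b.C₀ * (2 * ‖x - y‖) ^ 2)) := by
        rw [abs_neg, abs_of_pos (by norm_num : (0 : ℝ) < 4)]
        gcongr
        refine (b.abs_rinner_sub_proj_le hx hy).trans ?_
        gcongr
        exact b.norm_sub_proj_le hx hy
    _ = 16 * b.C₀ * Metric.infDist x (frontier Ω) * ‖x - y‖ ^ 2 := by ring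

/-- near the boundary, |x − y| and |x̄ − y| are comparable for y ∈ ∂Ω,
with the quantitative estimate ||x−y|² − |x̄−y|²| ≤ C d(x) min{|x−y|², |x̄−y|²}. -/
theorem reflection_comparable_on_boundary (Ω : Set ℂ) (hΩo : IsOpen Ω) (hΩc : IsConnected Ω)
    (hΩb : Bornology.IsBounded Ω) (b : C2Boundary Ω) :
    ∃ δ₁ : ℝ, 0 < δ₁ ∧ δ₁ ≤ b.δ₀ ∧ ∃ c C : ℝ, 0 < c ∧ c ≤ C ∧
      ∀ x ∈ Ω, Metric.infDist x (frontier Ω) < δ₁ → ∀ y ∈ frontier Ω,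
        c * ‖b.refl x - y‖ ≤ ‖x - y‖ ∧ ‖x - y‖ ≤ C * ‖b.refl x - y‖ ∧
        |‖x - y‖ ^ 2 - ‖b.refl x - y‖ ^ 2| ≤
          C * Metric.infDist x (frontier Ω) * min (‖x - y‖ ^ 2) (‖b.refl x - y‖ ^ 2) := by
  have hC := b.C₀_pos
  refine ⟨min b.δ₀ (1 / (32 * b.C₀)), lt_min b.δ₀_pos (by positivity), min_le_left _ _,
    1 / 2, max 2 (32 * b.C₀), by norm_num, le_max_of_le_left (by norm_num), ?_⟩
  intro x hx hxd y hy
  have key := b.abs_sq_norm_sub_sub_le ⟨hx, hxd.trans_le (min_le_left _ _)⟩ hy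
  have hd : 0 ≤ Metric.infDist x (frontier Ω) := Metric.infDist_nonneg
  have hsmall : 32 * b.C₀ * Metric.infDist x (frontier Ω) ≤ 1 := by
    have h := (hxd.trans_le (min_le_right _ _)).le
    rw [le_div_iff₀ (by positivity)] at h
    linarith
  set d := Metric.infDist x (frontier Ω)
  have hA := norm_nonneg (x - y)
  have hB := norm_nonneg (b.refl x - y)
  set A := ‖x - y‖
  set B := ‖b.refl x - y‖
  have hhalf : |A ^ 2 - B ^ 2| ≤ A ^ 2 / 2 := by
    nlinarith [mul_le_mul_of_nonneg_right hsmall (sq_nonneg A)]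
  obtain ⟨hlo, hhi⟩ := abs_le.mp hhalf
  have hAB : A ≤ 2 * B := abs_le_of_sq_le_sq' (by nlinarith) (by positivity) |>.2
  have hBA : B ≤ 2 * A := abs_le_of_sq_le_sq' (by nlinarith) (by positivity) |>.2
  refine ⟨by linarith, hAB.trans (by gcongr; exact le_max_left _ _), ?_⟩
  calc |A ^ 2 - B ^ 2| ≤ 32 * b.C₀ * d * min (A ^ 2) (B ^ 2) := by
        rw [mul_min_of_nonneg _ _ (by positivity)]
        refine le_min (key.trans ?_) (key.trans ?_)
        · gcongr
          norm_num
        · calc 16 * b.C₀ * d * A ^ 2 ≤ 16 * b.C₀ * d * (2 * B ^ 2) := by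
                gcongr
                linarith
            _ = 32 * b.C₀ * d * B ^ 2 := by ring
    _ ≤ max 2 (32 * b.C₀) * d * min (A ^ 2) (B ^ 2) := by
        gcongr
        exact le_max_right _ _
end

section
/- For every γ = (γ₁,…,γ_N) ∈ ℱ there exists ξ_γ ∈ W such that (γ_j(ξ_γ) − p_r)/|γ_j(ξ_γ) − p_r| = e^{i(θ_{p_r} + jδ/N)} for all j ∈ I_r and r = 1,…,m; that is, every admissible deformation of K maps some configuration of W onto a configuration whose components lie on the prescribed rays emanating from the singular points p_r. -/
open Real Set Metric Filter MeasureTheory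

/-- The function Ψ(ξ) = (1/2)ΣH(ξ_j,ξ_j) − Σ_p (α_p/2)Σ_j G(ξ_j,p) + (1/2)Σ_{j≠k}G(ξ_j,ξ_k). -/
noncomputable def PsiFun (H : ℂ → ℂ → ℝ) (Z : Finset ℂ) (α : ℂ → ℝ) {N : ℕ}
    (ξ : Fin N → ℂ) : ℝ :=
  (1 / 2) * ∑ j, H (ξ j) (ξ j) - ∑ p ∈ Z, (α p / 2) * ∑ j, green H (ξ j) p +
    (1 / 2) * ∑ j, ∑ k, if j ≠ k then green H (ξ j) (ξ k) else 0

/-- The function Φ(ξ) = (1/2)ΣH(ξ_j,ξ_j) − Σ_p (α_p/2)Σ_j G(ξ_j,p) − (1/2)Σ_{j≠k}G(ξ_j,ξ_k). -/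
noncomputable def PhiFun (H : ℂ → ℂ → ℝ) (Z : Finset ℂ) (α : ℂ → ℝ) {N : ℕ}
    (ξ : Fin N → ℂ) : ℝ :=
  (1 / 2) * ∑ j, H (ξ j) (ξ j) - ∑ p ∈ Z, (α p / 2) * ∑ j, green H (ξ j) p -
    (1 / 2) * ∑ j, ∑ k, if j ≠ k then green H (ξ j) (ξ k) else 0

/-- Membership in the configuration space ℳ = {ξ ∈ (Ω∖Z)^N : ξ_j ≠ ξ_k for j ≠ k}. -/
def memM (Ω : Set ℂ) (Z : Finset ℂ) {N : ℕ} (ξ : Fin N → ℂ) : Prop :=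
  (∀ j, ξ j ∈ Ω ∧ ξ j ∉ Z) ∧ Function.Injective ξ

/-- The cone {p + ρe^{i(θ_p+t)} : ρ ≥ 0, |t| ≤ δ} with vertex p. -/
def coneAt (θ : ℂ → ℝ) (δ : ℝ) (p : ℂ) : Set ℂ :=
  {z | ∃ ρ : ℝ, 0 ≤ ρ ∧ ∃ t : ℝ, |t| ≤ δ ∧
    z = p + (ρ : ℂ) * Complex.exp (((θ p + t : ℝ) : ℂ) * Complex.I)}

/-- Start index of the r-th consecutive block I_r of {0,…,N−1}. -/
def blkLo {m : ℕ} (Nr : Fin m → ℕ) (r : Fin m) : ℕ :=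
  ∑ s ∈ Finset.univ.filter (fun s => s < r), Nr s

/-- `inBlk Nr r j`: the index j belongs to the r-th consecutive block I_r. -/
def inBlk {m : ℕ} (Nr : Fin m → ℕ) (r : Fin m) {N : ℕ} (j : Fin N) : Prop :=
  blkLo Nr r ≤ (j : ℕ) ∧ (j : ℕ) < blkLo Nr r + Nr r

/-- `onRays θ δ P Nr ξ`: for every r and every j ∈ I_r the point ξ_j lies on the ray
emanating from p_r with angle θ_{p_r} + jδ/N, i.e. (ξ_j − p_r)/|ξ_j − p_r| = e^{i(θ_{p_r}+jδ/N)}. -/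
def onRays (θ : ℂ → ℝ) (δ : ℝ) {m : ℕ} (P : Fin m → ℂ) (Nr : Fin m → ℕ) {N : ℕ}
    (ξ : Fin N → ℂ) : Prop :=
  ∀ r : Fin m, ∀ j : Fin N, inBlk Nr r j →
    ξ j - P r = (‖ξ j - P r‖ : ℂ) *
      Complex.exp (((θ (P r) + ((j : ℕ) + 1) * δ / (N : ℝ) : ℝ) : ℂ) * Complex.I)

/-- The annulus U_r = {ξ : δ < |ξ − p| < 2δ}. -/
def annU (δ : ℝ) (p : ℂ) : Set ℂ := {z | δ < ‖z - p‖ ∧ ‖z - p‖ < 2 * δ}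

/-- The open set {ξ ∈ U₁^{N₁} × … × U_m^{N_m} : |ξ_j − ξ_k| > M⁻¹ for j ≠ k}. -/
def cfgOpen (δ : ℝ) {m : ℕ} (P : Fin m → ℂ) (Nr : Fin m → ℕ) (N : ℕ) (M : ℝ) :
    Set (Fin N → ℂ) :=
  {ξ | (∀ r : Fin m, ∀ j : Fin N, inBlk Nr r j → ξ j ∈ annU δ (P r)) ∧
    ∀ j k : Fin N, j ≠ k → M⁻¹ < ‖ξ j - ξ k‖}

/-- W = the connected component of the above open set containing ξ⁰. -/
def Wset (δ : ℝ) {m : ℕ} (P : Fin m → ℂ) (Nr : Fin m → ℕ) {N : ℕ} (ξ0 : Fin N → ℂ)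
    (M : ℝ) : Set (Fin N → ℂ) :=
  connectedComponentIn (cfgOpen δ P Nr N M) ξ0

/-- K = the closure of W. -/
def Kset (δ : ℝ) {m : ℕ} (P : Fin m → ℂ) (Nr : Fin m → ℕ) {N : ℕ} (ξ0 : Fin N → ℂ)
    (M : ℝ) : Set (Fin N → ℂ) :=
  closure (Wset δ P Nr ξ0 M)

/-- K₀ = {ξ ∈ K : min_{j≠k}|ξ_j − ξ_k| = M⁻¹}. -/
def K0set (δ : ℝ) {m : ℕ} (P : Fin m → ℂ) (Nr : Fin m → ℕ) {N : ℕ} (ξ0 : Fin N → ℂ)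
    (M : ℝ) : Set (Fin N → ℂ) :=
  {ξ | ξ ∈ Kset δ P Nr ξ0 M ∧ (∀ j k : Fin N, j ≠ k → M⁻¹ ≤ ‖ξ j - ξ k‖) ∧
    ∃ j k : Fin N, j ≠ k ∧ ‖ξ j - ξ k‖ = M⁻¹}

/-- 𝒟 = {ξ ∈ ℳ : Φ(ξ) > −M}. -/
def Dset (Ω : Set ℂ) (H : ℂ → ℂ → ℝ) (Z : Finset ℂ) (α : ℂ → ℝ) {N : ℕ} (M : ℝ) :
    Set (Fin N → ℂ) :=
  {ξ | memM Ω Z ξ ∧ -M < PhiFun H Z α ξ}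

/-- ℱ: continuous maps γ : K → 𝒟 homotopic to the identity within 𝒟, the homotopy
fixing K₀ pointwise. -/
def inF (Ω : Set ℂ) (H : ℂ → ℂ → ℝ) (Z : Finset ℂ) (α : ℂ → ℝ) (δ : ℝ) {m : ℕ}
    (P : Fin m → ℂ) (Nr : Fin m → ℕ) {N : ℕ} (ξ0 : Fin N → ℂ) (M : ℝ)
    (γ : (Fin N → ℂ) → (Fin N → ℂ)) : Prop :=
  ContinuousOn γ (Kset δ P Nr ξ0 M) ∧
  Set.MapsTo γ (Kset δ P Nr ξ0 M) (Dset Ω H Z α M) ∧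
  ∃ Γ : ℝ × (Fin N → ℂ) → (Fin N → ℂ),
    ContinuousOn Γ (Set.Icc (0 : ℝ) 1 ×ˢ Kset δ P Nr ξ0 M) ∧
    Set.MapsTo Γ (Set.Icc (0 : ℝ) 1 ×ˢ Kset δ P Nr ξ0 M) (Dset Ω H Z α M) ∧
    (∀ ξ ∈ Kset δ P Nr ξ0 M, Γ (0, ξ) = ξ) ∧
    (∀ ξ ∈ Kset δ P Nr ξ0 M, Γ (1, ξ) = γ ξ) ∧
    ∀ t ∈ Set.Icc (0 : ℝ) 1, ∀ ξ ∈ K0set δ P Nr ξ0 M, Γ (t, ξ) = ξ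

/-- The max-min value Ψ*_M = sup_{γ∈ℱ} min_{ξ∈K} Ψ(γ(ξ)). -/
noncomputable def PsiStar (Ω : Set ℂ) (H : ℂ → ℂ → ℝ) (Z : Finset ℂ) (α : ℂ → ℝ)
    (δ : ℝ) {m : ℕ} (P : Fin m → ℂ) (Nr : Fin m → ℕ) {N : ℕ} (ξ0 : Fin N → ℂ)
    (M : ℝ) : ℝ :=
  sSup {v | ∃ γ : (Fin N → ℂ) → (Fin N → ℂ), inF Ω H Z α δ P Nr ξ0 M γ ∧
    v = sInf ((fun ξ => PsiFun H Z α (γ ξ)) '' Kset δ P Nr ξ0 M)}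

section LatticePeriodic

variable {ι E : Type*} [Fintype ι] [NormedAddCommGroup E] [NormedSpace ℝ E]
  (b : Module.Basis ι ℝ E)

/-- `f` is invariant under translation by the lattice spanned by the basis `b`. -/
def LatticePeriodic {F : Type*} (f : E → F) : Prop :=
  ∀ v ∈ Submodule.span ℤ (Set.range b), ∀ x, f (x + v) = f x

variable {b}

theorem LatticePeriodic.eq_fract {F : Type*} {f : E → F} (hf : LatticePeriodic b f) (x : E) :
    f x = f (ZSpan.fract b x) := by
  have := hf _ (ZSpan.floor b x).2 (ZSpan.fract b x)
  rw [ZSpan.fract_apply, sub_add_cancel] at this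
  exact this

theorem LatticePeriodic.exists_norm_le {F : Type*} [NormedAddCommGroup F] {f : E → F}
    (hf : LatticePeriodic b f) (hc : Continuous f) : ∃ C, ∀ x, ‖f x‖ ≤ C := by
  have : FiniteDimensional ℝ E := b.finiteDimensional_of_finite
  have : ProperSpace E := FiniteDimensional.proper ℝ E
  have hK : IsCompact (closure (ZSpan.fundamentalDomain b)) :=
    (ZSpan.fundamentalDomain_isBounded b).isCompact_closure
  obtain ⟨C, hC⟩ := hK.exists_bound_of_continuousOn hc.continuousOn
  refine ⟨C, fun x => ?_⟩
  rw [hf.eq_fract]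
  exact hC _ (subset_closure (ZSpan.fract_mem_fundamentalDomain b x))

theorem LatticePeriodic.uniformContinuous {F : Type*} [NormedAddCommGroup F] {f : E → F}
    (hf : LatticePeriodic b f) (hc : Continuous f) : UniformContinuous f := by
  have : FiniteDimensional ℝ E := b.finiteDimensional_of_finite
  have : ProperSpace E := FiniteDimensional.proper ℝ E
  have hK : IsCompact (closure (ZSpan.fundamentalDomain b)) :=
    (ZSpan.fundamentalDomain_isBounded b).isCompact_closure
  rw [Metric.uniformContinuous_iff]
  intro ε hε
  have h := hK.uniformContinuousAt_of_continuousAt f (fun a _ => hc.continuousAt)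
    (Metric.dist_mem_uniformity hε)
  obtain ⟨d, hd, h⟩ := Metric.mem_uniformity_dist.1 h
  refine ⟨d, hd, fun {x y} hxy => ?_⟩
  have h1 := hf _ (neg_mem (ZSpan.floor b x).2) y
  rw [hf.eq_fract x, ← h1]
  refine h (a := ZSpan.fract b x) (b := y + -(ZSpan.floor b x : E)) ?_
    (subset_closure (ZSpan.fract_mem_fundamentalDomain b x))
  rwa [ZSpan.fract_apply, sub_eq_add_neg, dist_add_right]

omit [Fintype ι] in
theorem LatticePeriodic.latticePeriodic_fderiv {F : Type*} [NormedAddCommGroup F] [NormedSpace ℝ F] {f : E → F}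
    (hf : LatticePeriodic b f) : LatticePeriodic b (fderiv ℝ f) := by
  intro v hv x
  rw [← fderiv_comp_add_right]
  congr 1
  ext y
  exact hf v hv y

variable [MeasurableSpace E] [BorelSpace E] (μ : Measure E) [μ.IsAddHaarMeasure]

theorem LatticePeriodic.measure_image_id_add {g : E → E} (hg : LatticePeriodic b g)
    (hd : Differentiable ℝ g) {K : NNReal} (hK : K < 1) (hl : LipschitzWith K g) :
    Function.Injective (fun x => x + g x) ∧
    μ ((fun x => x + g x) '' ZSpan.fundamentalDomain b) = μ (ZSpan.fundamentalDomain b) := by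
  have : FiniteDimensional ℝ E := b.finiteDimensional_of_finite
  have : CompleteSpace E := FiniteDimensional.complete ℝ E
  have happ : ApproximatesLinearOn (fun x => x + g x)
      ((ContinuousLinearEquiv.refl ℝ E : E ≃L[ℝ] E) : E →L[ℝ] E) univ K := by
    intro x _ y _
    have := hl.dist_le_mul x y
    rw [dist_eq_norm, dist_eq_norm] at this
    have e : x + g x - (y + g y) - (ContinuousLinearEquiv.refl ℝ E : E →L[ℝ] E) (x - y) =
        g x - g y := by
      change x + g x - (y + g y) - (x - y) = g x - g y
      abel
    rw [e]
    exact this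
  have hc : Subsingleton E ∨ K <
      ‖((ContinuousLinearEquiv.refl ℝ E).symm : E →L[ℝ] E)‖₊⁻¹ := by
    rcases subsingleton_or_nontrivial E with h | h
    · exact Or.inl h
    · right
      have : ‖((ContinuousLinearEquiv.refl ℝ E).symm : E →L[ℝ] E)‖₊ = 1 := by
        rw [ContinuousLinearEquiv.refl_symm]
        exact ContinuousLinearMap.nnnorm_id
      rw [this, inv_one]
      exact hK
  let Φ : E ≃ₜ E := happ.toHomeomorph _ hc
  refine ⟨Φ.injective, ?_⟩
  have hD := ZSpan.isAddFundamentalDomain' b μ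
  have hq : Measure.QuasiMeasurePreserving Φ.toEquiv.symm μ μ := by
    have hm : Measurable Φ.toEquiv.symm := Φ.symm.continuous.measurable
    refine ⟨hm, Measure.AbsolutelyContinuous.mk fun s hs h0 => ?_⟩
    rw [Measure.map_apply hm hs]
    have : Φ.toEquiv.symm ⁻¹' s = (fun x => x + g x) '' s :=
      (Φ.toEquiv.image_eq_preimage_symm s).symm
    rw [this]
    exact addHaar_image_eq_zero_of_differentiableOn_of_addHaar_eq_zero μ
      (differentiable_id.add hd).differentiableOn h0
  have h2 := hD.image_of_equiv Φ.toEquiv hq (Equiv.refl _) (by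
    intro v x
    change (v : E) + x + g (v + x) = v + (x + g x)
    rw [add_comm (v : E) x, hg _ v.2]
    abel)
  have : DiscreteTopology (Submodule.span ℤ (Set.range b)).toAddSubgroup := inferInstance
  have hcount : Countable (Submodule.span ℤ (Set.range b)) := inferInstance
  have : Countable (Submodule.span ℤ (Set.range b)).toAddSubgroup := hcount
  exact h2.measure_eq hD

omit [Fintype ι] [MeasurableSpace E] [BorelSpace E] in
theorem exists_polynomial_eval_eq_det_one_add_smul [Finite ι] (b : Module.Basis ι ℝ E) (A : E →L[ℝ] E) :
    ∃ p : Polynomial ℝ, p.degree < (Nat.card ι + 1 : ℕ) ∧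
      ∀ t : ℝ, p.eval t = (1 + t • A).det := by
  classical
  cases nonempty_fintype ι
  let M := LinearMap.toMatrix b b (A : E →ₗ[ℝ] E)
  refine ⟨((Polynomial.X : Polynomial ℝ) • M.map Polynomial.C +
    (1 : Matrix ι ι ℝ).map Polynomial.C).det, ?_, fun t => ?_⟩
  · refine Polynomial.degree_lt_iff_coeff_zero _ _ |>.2 fun k hk => ?_
    refine Polynomial.coeff_eq_zero_of_natDegree_lt ?_
    have := Polynomial.natDegree_det_X_add_C_le M 1
    rw [Nat.card_eq_fintype_card] at hk
    omega
  · rw [ContinuousLinearMap.det, ← LinearMap.det_toMatrix b, ← Polynomial.coe_evalRingHom,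
      RingHom.map_det]
    congr 1
    ext i j
    simp [M, Matrix.one_apply, LinearMap.toMatrix_apply]
    by_cases h : i = j
    · subst h
      simp
      ring
    · simp [h]
      ring

theorem LatticePeriodic.exists_setIntegral_det_one_add_smul {g : E → E} (hg : LatticePeriodic b g)
    (hd : ContDiff ℝ 1 g) : ∃ τ > 0, ∀ t : ℝ, |t| ≤ τ →
      ∫ x in ZSpan.fundamentalDomain b, (1 + t • fderiv ℝ g x).det ∂μ =
        μ.real (ZSpan.fundamentalDomain b) := by
  have : FiniteDimensional ℝ E := b.finiteDimensional_of_finite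
  have hdiff : Differentiable ℝ g := hd.differentiable one_ne_zero
  obtain ⟨C, hC⟩ := hg.latticePeriodic_fderiv.exists_norm_le (hd.continuous_fderiv one_ne_zero)
  have hC0 : 0 ≤ C := (norm_nonneg _).trans (hC 0)
  have hdet : ∀ᶠ B : E →L[ℝ] E in nhds 0, 0 < (1 + B).det := by
    have hcont : Continuous fun B : E →L[ℝ] E => (1 + B).det :=
      ContinuousLinearMap.continuous_det.comp (continuous_const.add continuous_id)
    refine hcont.continuousAt.eventually (lt_mem_nhds ?_)
    simp [ContinuousLinearMap.det]
  obtain ⟨η, hη, hball⟩ := Metric.eventually_nhds_iff.1 hdet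
  refine ⟨min (1 / 2) (η / 2) / (C + 1), by positivity, fun t ht => ?_⟩
  have hb : ∀ x, ‖t • fderiv ℝ g x‖ ≤ min (1 / 2) (η / 2) := by
    intro x
    rw [norm_smul, Real.norm_eq_abs]
    calc |t| * ‖fderiv ℝ g x‖ ≤ min (1 / 2) (η / 2) / (C + 1) * (C + 1) := by
          gcongr
          exact (hC x).trans (by linarith)
      _ = _ := div_mul_cancel₀ _ (by positivity)
  have hper : LatticePeriodic b (t • g) := fun v hv x => by simp [hg v hv x]
  have hl : LipschitzWith (1 / 2) (t • g) := by
    refine lipschitzWith_of_nnnorm_fderiv_le (hdiff.const_smul t) fun x => ?_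
    rw [fderiv_const_smul (hdiff x), ← NNReal.coe_le_coe, coe_nnnorm]
    exact (hb x).trans ((min_le_left _ _).trans (by simp))
  obtain ⟨hinj, hμ⟩ := hper.measure_image_id_add μ (hdiff.const_smul t) (K := 1 / 2)
    (by norm_num [← NNReal.coe_lt_coe]) hl
  have hint := integral_image_eq_integral_abs_det_fderiv_smul μ
    (ZSpan.fundamentalDomain_measurableSet b) (f := fun x => x + (t • g) x)
    (f' := fun x => 1 + t • fderiv ℝ g x)
    (fun x _ => ((hasFDerivAt_id x).add
      ((hdiff x).hasFDerivAt.const_smul t)).hasFDerivWithinAt) hinj.injOn (fun _ => (1 : ℝ))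
  rw [setIntegral_const, smul_eq_mul, mul_one, Measure.real, hμ] at hint
  rw [Measure.real, hint]
  congr 1
  ext x
  rw [smul_eq_mul, mul_one, abs_of_pos]
  refine hball ?_
  rw [dist_zero_right]
  linarith [hb x, min_le_right (1 / 2 : ℝ) (η / 2)]

theorem LatticePeriodic.setIntegral_det_one_add_fderiv {g : E → E} (hg : LatticePeriodic b g)
    (hd : ContDiff ℝ 1 g) :
    ∫ x in ZSpan.fundamentalDomain b, (1 + fderiv ℝ g x).det ∂μ =
      μ.real (ZSpan.fundamentalDomain b) := by
  have : FiniteDimensional ℝ E := b.finiteDimensional_of_finite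
  have : ProperSpace E := FiniteDimensional.proper ℝ E
  obtain ⟨τ, hτ, h⟩ := hg.exists_setIntegral_det_one_add_smul μ hd
  set n := Nat.card ι + 1
  let v : ℕ → ℝ := fun k => τ / (k + 1)
  have hv : Set.InjOn v (Finset.range n) := by
    intro i _ j _ hij
    have : (i : ℝ) + 1 = j + 1 := by
      have h1 : (0 : ℝ) < i + 1 := by positivity
      have h2 : (0 : ℝ) < j + 1 := by positivity
      simp only [v] at hij
      rw [div_eq_div_iff h1.ne' h2.ne'] at hij
      exact (mul_left_cancel₀ hτ.ne' hij).symm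
    have h3 : i + 1 = j + 1 := by exact_mod_cast this
    omega
  have hvτ : ∀ i, |v i| ≤ τ := fun i => by
    rw [abs_of_pos (by positivity)]
    exact div_le_self hτ.le (by linarith [Nat.cast_nonneg (α := ℝ) i])
  let w : ℕ → ℝ := fun i => (Lagrange.basis (Finset.range n) v i).eval 1
  have hw : ∑ i ∈ Finset.range n, w i = 1 := by
    rw [← Polynomial.eval_finsetSum, Lagrange.sum_basis hv (by simp [n]), Polynomial.eval_one]
  have hinterp : ∀ x, (1 + fderiv ℝ g x).det =
      ∑ i ∈ Finset.range n, w i * (1 + v i • fderiv ℝ g x).det := by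
    intro x
    obtain ⟨p, hp, hpt⟩ := exists_polynomial_eval_eq_det_one_add_smul b (fderiv ℝ g x)
    have h1 := Lagrange.eq_interpolate (f := p) hv (by simpa [n] using hp)
    have h2 := hpt 1
    rw [one_smul] at h2
    rw [← h2, h1, Lagrange.interpolate_apply, Polynomial.eval_finsetSum]
    refine Finset.sum_congr rfl fun i _ => ?_
    rw [Polynomial.eval_mul, Polynomial.eval_C, hpt, mul_comm]
  have hint : ∀ t : ℝ, IntegrableOn (fun x => (1 + t • fderiv ℝ g x).det)
      (ZSpan.fundamentalDomain b) μ := by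
    intro t
    have hcont : Continuous fun x => (1 + t • fderiv ℝ g x).det :=
      ContinuousLinearMap.continuous_det.comp
        (continuous_const.add ((hd.continuous_fderiv one_ne_zero).const_smul t))
    exact (hcont.continuousOn.integrableOn_compact
      (ZSpan.fundamentalDomain_isBounded b).isCompact_closure).mono_set subset_closure
  simp_rw [hinterp]
  rw [integral_finsetSum _ fun i _ => (hint (v i)).const_mul (w i)]
  simp_rw [integral_const_mul, h _ (hvτ _)]
  rw [← Finset.sum_mul, hw, one_mul]

end LatticePeriodic

theorem exists_contDiff_circle_collapse {ε : ℝ} (hε : 0 < ε) :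
    ∃ c : ℝ → ℝ, ContDiff ℝ 1 c ∧ (∀ (s : ℝ) (n : ℤ), c (s + n) = c s + n) ∧
      ∀ s : ℝ, (∀ n : ℤ, ε ≤ |s - n|) → deriv c s = 0 := by
  set ε' := min ε (1 / 2)
  have hε' : 0 < ε' := by positivity
  let h : ℝ → ℝ := fun s => max 0 (cos (2 * π * s) - cos (2 * π * ε'))
  have hcont : Continuous h := by fun_prop
  have hper : Function.Periodic h 1 := fun s => by
    simp only [h, mul_add, mul_one, Real.cos_add_two_pi]
  set I := ∫ s in (0 : ℝ)..1, h s
  have hI : 0 < I := by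
    refine intervalIntegral.integral_pos zero_lt_one hcont.continuousOn
      (fun s _ => le_max_left _ _) ⟨0, by simp, lt_max_of_lt_right ?_⟩
    rw [sub_pos, mul_zero]
    refine Real.cos_lt_cos_of_nonneg_of_le_pi le_rfl ?_ (by positivity)
    nlinarith [min_le_right ε (1 / 2), Real.pi_pos]
  have hderiv : ∀ s, HasDerivAt (fun s => I⁻¹ * ∫ u in (0 : ℝ)..s, h u) (I⁻¹ * h s) s := fun s =>
    (hcont.integral_hasStrictDerivAt 0 s).hasDerivAt.const_mul _
  refine ⟨fun s => I⁻¹ * ∫ u in (0 : ℝ)..s, h u, ?_, ?_, ?_⟩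
  · rw [contDiff_one_iff_deriv]
    refine ⟨fun s => (hderiv s).differentiableAt, ?_⟩
    have : deriv (fun s => I⁻¹ * ∫ u in (0 : ℝ)..s, h u) = fun s => I⁻¹ * h s :=
      funext fun s => (hderiv s).deriv
    rw [this]
    fun_prop
  · intro s n
    have hii : ∀ a b, IntervalIntegrable h volume a b := fun a b => hcont.intervalIntegrable a b
    have h1 : ∫ u in s..s + n, h u = n * I := by
      have h2 := hper.intervalIntegral_add_zsmul_eq n s hii
      rw [zsmul_eq_mul, zsmul_eq_mul, mul_one, hper.intervalIntegral_add_eq s 0, zero_add] at h2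
      exact h2
    simp only
    rw [← intervalIntegral.integral_add_adjacent_intervals (hii 0 s) (hii s (s + n)), h1]
    field_simp
  · intro s hs
    rw [(hderiv s).deriv]
    have h1 := hs (round s)
    have h2 := abs_sub_round s
    have h3 : cos (2 * π * s) = cos (2 * π * |s - round s|) := by
      have : 2 * π * |s - round s| = |2 * π * (s - round s)| := by
        rw [abs_mul, abs_of_pos (by positivity : (0 : ℝ) < 2 * π)]
      rw [this, Real.cos_abs, mul_sub, mul_comm (2 * π) (round s : ℝ), Real.cos_sub_int_mul_two_pi]
    have h4 : cos (2 * π * |s - round s|) ≤ cos (2 * π * ε') := by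
      refine Real.cos_le_cos_of_nonneg_of_le_pi (by positivity) ?_ ?_
      · nlinarith [Real.pi_pos]
      · gcongr
        exact (min_le_left _ _).trans h1
    have h5 : h s = 0 := max_eq_left (by rw [h3]; linarith)
    rw [h5, mul_zero]

theorem mem_span_range_basisFun_iff {ι : Type*} [Finite ι] (v : ι → ℝ) :
    v ∈ Submodule.span ℤ (Set.range (Pi.basisFun ℝ ι)) ↔ ∃ n : ι → ℤ, ∀ i, v i = n i := by
  rw [(Pi.basisFun ℝ ι).mem_span_iff_repr_mem ℤ v]
  constructor
  · intro h
    choose n hn using h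
    exact ⟨n, fun i => by simpa using (hn i).symm⟩
  · rintro ⟨n, hn⟩ i
    exact ⟨n i, by simp [hn]⟩

theorem LatticePeriodic.exists_norm_lt_of_contDiff {ι : Type*} [Fintype ι]
    {g : (ι → ℝ) → (ι → ℝ)} (hg : LatticePeriodic (Pi.basisFun ℝ ι) g) (hd : ContDiff ℝ 1 g)
    (y : ι → ℝ) {ε : ℝ} (hε : 0 < ε) : ∃ x, ‖x + g x - y‖ < ε := by
  classical
  by_contra! hfar
  obtain ⟨c, hc, hcper, hc0⟩ := exists_contDiff_circle_collapse hε
  have hgap : ∀ x, ∃ i, ∀ n : ℤ, ε ≤ |x i + g x i - y i - n| := by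
    intro x
    by_contra! hx
    choose n hn using hx
    have hv : (fun i => (n i : ℝ)) ∈ Submodule.span ℤ (Set.range (Pi.basisFun ℝ ι)) :=
      (mem_span_range_basisFun_iff _).2 ⟨n, fun _ => rfl⟩
    refine (hfar (x - fun i => (n i : ℝ))).not_gt ?_
    rw [sub_eq_add_neg x, hg _ (neg_mem hv), pi_norm_lt_iff hε]
    intro i
    have e : (x + -(fun i => (n i : ℝ)) + g x - y) i = x i + g x i - y i - n i := by
      simp only [Pi.sub_apply, Pi.add_apply, Pi.neg_apply]
      ring
    rw [e]
    exact hn i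
  let k : (ι → ℝ) → (ι → ℝ) := fun x i => c (x i + g x i - y i) - x i
  have hgi : ∀ i, ContDiff ℝ 1 fun x => g x i := contDiff_pi.1 hd
  have hin : ∀ i, ContDiff ℝ 1 fun x : ι → ℝ => x i + g x i - y i := fun i =>
    ((contDiff_apply ℝ ℝ i).add (hgi i)).sub contDiff_const
  have hkd : ContDiff ℝ 1 k := contDiff_pi.2 fun i =>
    (hc.comp (hin i)).sub (contDiff_apply ℝ ℝ i)
  have hk : LatticePeriodic (Pi.basisFun ℝ ι) k := by
    intro v hv x
    obtain ⟨n, hn⟩ := (mem_span_range_basisFun_iff v).1 hv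
    ext i
    simp only [k, hg v hv x, Pi.add_apply, hn i]
    have : x i + n i + g x i - y i = x i + g x i - y i + n i := by ring
    rw [this, hcper]
    ring
  have hdet : ∀ x, (1 + fderiv ℝ k x).det = 0 := by
    intro x
    obtain ⟨i, hi⟩ := hgap x
    have hrow : ∀ w, (1 + fderiv ℝ k x) w i = 0 := by
      intro w
      have h1 : HasFDerivAt (fun z => k z i)
          ((ContinuousLinearMap.proj i).comp (fderiv ℝ k x)) x :=
        hasFDerivAt_pi'.1 (hkd.differentiable one_ne_zero x).hasFDerivAt i
      have h2 : HasFDerivAt (fun z => k z i)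
          (deriv c (x i + g x i - y i) • fderiv ℝ (fun x : ι → ℝ => x i + g x i - y i) x -
            ContinuousLinearMap.proj i) x := by
        refine HasFDerivAt.sub ?_ (hasFDerivAt_apply i x)
        exact ((hc.differentiable one_ne_zero _).hasDerivAt).comp_hasFDerivAt x
          ((hin i).differentiable one_ne_zero x).hasFDerivAt
      have h3 := congrArg (fun L => L w) (h1.unique h2)
      simp only [hc0 _ hi, zero_smul, zero_sub] at h3
      change w i + fderiv ℝ k x w i = 0
      change fderiv ℝ k x w i = - w i at h3
      rw [h3, add_neg_cancel]
    rw [ContinuousLinearMap.det, ← LinearMap.det_toMatrix']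
    exact Matrix.det_eq_zero_of_row_eq_zero i fun j => hrow _
  have hI := hk.setIntegral_det_one_add_fderiv volume hkd
  simp only [hdet, integral_zero] at hI
  rw [ZSpan.volume_real_fundamentalDomain] at hI
  have hone : Matrix.of (Pi.basisFun ℝ ι) = 1 := by
    ext i j
    simp [Matrix.one_apply, Pi.single_apply, eq_comm]
  simp [hone] at hI

theorem LatticePeriodic.exists_contDiff_dist_le {ι E : Type*} [Fintype ι]
    [NormedAddCommGroup E] [NormedSpace ℝ E] {b : Module.Basis ι ℝ E} {F : Type*}
    [NormedAddCommGroup F] [NormedSpace ℝ F] [CompleteSpace F] {g : E → F}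
    (hg : LatticePeriodic b g)
    (hc : Continuous g) {ε : ℝ} (hε : 0 < ε) :
    ∃ f : E → F, LatticePeriodic b f ∧ ContDiff ℝ 1 f ∧ ∀ x, dist (f x) (g x) ≤ ε := by
  have : FiniteDimensional ℝ E := b.finiteDimensional_of_finite
  borelize E
  let μ : Measure E := MeasureTheory.Measure.addHaar
  obtain ⟨d, hd, h⟩ := Metric.uniformContinuous_iff.1 (hg.uniformContinuous hc) ε hε
  let φ : ContDiffBump (0 : E) := ⟨d / 2, d, by positivity, by linarith⟩
  refine ⟨convolution (φ.normed μ) g (ContinuousLinearMap.lsmul ℝ ℝ) μ, ?_, ?_, fun x => ?_⟩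
  · intro v hv x
    simp only [convolution_def]
    refine integral_congr_ae (Eventually.of_forall fun t => ?_)
    simp only
    rw [add_sub_right_comm, hg v hv]
  · exact φ.hasCompactSupport_normed.contDiff_convolution_left _ φ.contDiff_normed
      hc.locallyIntegrable
  · exact φ.dist_normed_convolution_le hc.aestronglyMeasurable fun z hz => (h hz).le

/-- A continuous map of a torus homotopic to the identity is surjective, stated for lifts. -/
theorem LatticePeriodic.exists_add_eq {ι : Type*} [Fintype ι]
    {g : (ι → ℝ) → (ι → ℝ)} (hg : LatticePeriodic (Pi.basisFun ℝ ι) g) (hc : Continuous g)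
    (y : ι → ℝ) : ∃ x, x + g x = y := by
  obtain ⟨C, hC⟩ := hg.exists_norm_le hc
  have hC0 : 0 ≤ C := (norm_nonneg _).trans (hC 0)
  have hcont : Continuous fun x => ‖x + g x - y‖ := by fun_prop
  obtain ⟨x₀, -, hmin⟩ := (isCompact_closedBall y (C + 1)).exists_isMinOn
    ⟨y, mem_closedBall_self (by positivity)⟩ hcont.continuousOn
  refine ⟨x₀, ?_⟩
  by_contra hne
  have hpos : 0 < ‖x₀ + g x₀ - y‖ := norm_pos_iff.2 (sub_ne_zero.2 hne)
  set ε := min 1 ‖x₀ + g x₀ - y‖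
  have hε : 0 < ε := by positivity
  have hfar : ∀ x, ε ≤ ‖x + g x - y‖ := by
    intro x
    by_cases hx : x ∈ closedBall y (C + 1)
    · exact (min_le_right _ _).trans (hmin hx)
    · rw [mem_closedBall, dist_eq_norm, not_le] at hx
      have h1 : ‖x - y‖ ≤ ‖x + g x - y‖ + ‖g x‖ := by
        have : x - y = (x + g x - y) - g x := by abel
        rw [this]
        exact norm_sub_le _ _
      exact (min_le_left _ _).trans (by linarith [hC x])
  obtain ⟨f, hf, hfd, hfg⟩ := hg.exists_contDiff_dist_le hc (half_pos hε)
  obtain ⟨x, hx⟩ := hf.exists_norm_lt_of_contDiff hfd y (half_pos hε)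
  have h1 : ‖x + g x - y‖ ≤ ‖x + f x - y‖ + ‖f x - g x‖ := by
    have : x + g x - y = (x + f x - y) - (f x - g x) := by abel
    rw [this]
    exact norm_sub_le _ _
  have h2 := hfg x
  rw [dist_eq_norm] at h2
  linarith [hfar x]

theorem exists_add_eq_of_periodic_two_pi {ι : Type*} [Fintype ι] {g : (ι → ℝ) → (ι → ℝ)}
    (hg : ∀ x (n : ι → ℤ), g (fun i => x i + n i * (2 * π)) = g x) (hc : Continuous g)
    (y : ι → ℝ) : ∃ x, x + g x = y := by
  have hpi : (2 * π) ≠ 0 := by positivity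
  let f : (ι → ℝ) → (ι → ℝ) := fun x => (2 * π)⁻¹ • g ((2 * π) • x)
  have hf : LatticePeriodic (Pi.basisFun ℝ ι) f := by
    intro v hv x
    obtain ⟨n, hn⟩ := (mem_span_range_basisFun_iff v).1 hv
    simp only [f]
    rw [← hg ((2 * π) • x) n]
    congr 2
    ext i
    simp only [Pi.smul_apply, Pi.add_apply, smul_eq_mul, hn]
    ring
  obtain ⟨x, hx⟩ := hf.exists_add_eq (by fun_prop) ((2 * π)⁻¹ • y)
  refine ⟨(2 * π) • x, ?_⟩
  have := congrArg (fun z => (2 * π) • z) hx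
  simpa only [f, smul_add, smul_smul, mul_inv_cancel₀ hpi, one_smul] using this

theorem closure_connectedComponentIn_inter_subset {X : Type*} [TopologicalSpace X] (U : Set X)
    (x : X) : closure (connectedComponentIn U x) ∩ U ⊆ connectedComponentIn U x := by
  rintro z ⟨hz, hzU⟩
  by_cases hx : x ∈ U
  · have hpre : IsPreconnected (insert z (connectedComponentIn U x)) :=
      isPreconnected_connectedComponentIn.subset_closure (subset_insert _ _)
        (insert_subset hz subset_closure)
    exact hpre.subset_connectedComponentIn (mem_insert_of_mem _ (mem_connectedComponentIn hx))
      (insert_subset hzU (connectedComponentIn_subset U x)) (mem_insert _ _)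
  · simp [connectedComponentIn_eq_empty hx] at hz

/-- A homotopy of nonvanishing complex functions on a compact set, stationary at the points of `T`
outside the open set `W`, turns the argument by a real amount that is continuous on `T`. -/
theorem exists_continuousOn_argument_displacement {X : Type*} [MetricSpace X] {K W T : Set X}
    (hK : IsCompact K) (hW : IsOpen W) (hT : IsClosed T) (hWK : W ⊆ K) {u : ℝ × X → ℂ}
    (hu : ContinuousOn u (Icc (0 : ℝ) 1 ×ˢ K)) (hu0 : ∀ z ∈ Icc (0 : ℝ) 1 ×ˢ K, u z ≠ 0)
    (hfix : ∀ t ∈ Icc (0 : ℝ) 1, ∀ x ∈ K, x ∈ T → x ∉ W → u (t, x) = u (0, x)) :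
    ∃ g : X → ℝ, ContinuousOn g T ∧ (∀ x ∈ T, x ∉ W → g x = 0) ∧
      ∀ x ∈ K, ∃ r : ℝ, 0 < r ∧ u (1, x) = r * Complex.exp (g x * Complex.I) * u (0, x) := by
  classical
  let Q : (ℝ × ℝ) × X → ℂ := fun z => u (z.1.1, z.2) / u (z.1.2, z.2)
  have hQ : ContinuousOn Q ((Icc (0 : ℝ) 1 ×ˢ Icc (0 : ℝ) 1) ×ˢ K) := by
    refine ContinuousOn.div (hu.comp (by fun_prop) fun z hz => ⟨hz.1.1, hz.2⟩)
      (hu.comp (by fun_prop) fun z hz => ⟨hz.1.2, hz.2⟩) fun z hz => hu0 _ ⟨hz.1.2, hz.2⟩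
  obtain ⟨d, hd, hQd⟩ := Metric.uniformContinuousOn_iff.1
    (((isCompact_Icc.prod isCompact_Icc).prod hK).uniformContinuousOn_of_continuous hQ) 1 one_pos
  obtain ⟨n, hn⟩ := exists_nat_one_div_lt hd
  have hn0 : (0 : ℝ) < n + 1 := by positivity
  let τ : ℕ → ℝ := fun k => k / (n + 1)
  have hτ : ∀ k ≤ n + 1, τ k ∈ Icc (0 : ℝ) 1 := fun k hk =>
    ⟨by positivity, (div_le_one hn0).2 (by exact_mod_cast hk)⟩
  let q : ℕ → X → ℂ := fun k x => u (τ (k + 1), x) / u (τ k, x)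
  have hslit : ∀ k < n + 1, ∀ x ∈ K, q k x ∈ Complex.slitPlane := by
    intro k hk x hx
    have h1 := hτ k hk.le
    have h2 := hτ (k + 1) hk
    have h3 := hQd ((τ (k + 1), τ k), x) ⟨⟨h2, h1⟩, hx⟩ ((τ k, τ k), x) ⟨⟨h1, h1⟩, hx⟩ (by
      have e : τ (k + 1) - τ k = 1 / (n + 1) := by
        simp only [τ]
        push_cast
        ring
      simp only [Prod.dist_eq, dist_self, Real.dist_eq, e]
      rw [abs_of_pos (by positivity)]
      simpa using ⟨by simpa using hn, hd⟩)
    have h4 : Q ((τ k, τ k), x) = 1 := div_self (hu0 _ ⟨h1, hx⟩)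
    rw [h4, dist_eq_norm] at h3
    have h5 := Complex.mem_slitPlane_of_norm_lt_one h3
    rwa [add_sub_cancel] at h5
  let g : X → ℝ := fun x => if x ∈ K then ∑ k ∈ Finset.range (n + 1), (q k x).arg else 0
  have hg0 : ∀ x ∈ T, x ∉ W → g x = 0 := by
    intro x hxT hxW
    by_cases hx : x ∈ K
    · simp only [g, if_pos hx]
      refine Finset.sum_eq_zero fun k hk => ?_
      have hk := Finset.mem_range.1 hk
      have : q k x = 1 := by
        simp only [q]
        rw [hfix _ (hτ (k + 1) hk) x hx hxT hxW, hfix _ (hτ k hk.le) x hx hxT hxW]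
        exact div_self (hu0 (0, x) ⟨by simp, hx⟩)
      rw [this, Complex.arg_one]
    · simp only [g, if_neg hx]
  refine ⟨g, ?_, hg0, fun x hx => ?_⟩
  · have hgK : ContinuousOn g K := by
      have hsum : ContinuousOn (fun x => ∑ k ∈ Finset.range (n + 1), (q k x).arg) K := by
        refine continuousOn_finsetSum _ fun k hk => ?_
        have hk := Finset.mem_range.1 hk
        have hqk : ContinuousOn (q k) K :=
          ContinuousOn.div (f := fun x => u (τ (k + 1), x)) (g := fun x => u (τ k, x))
            (hu.comp (f := fun x => (τ (k + 1), x)) (by fun_prop) fun x hx => ⟨hτ (k + 1) hk, hx⟩)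
            (hu.comp (f := fun x => (τ k, x)) (by fun_prop) fun x hx => ⟨hτ k hk.le, hx⟩)
            fun x (hx : x ∈ K) => hu0 (τ k, x) ⟨hτ k hk.le, hx⟩
        exact fun x hx => (Complex.continuousAt_arg (hslit k hk x hx)).comp_continuousWithinAt
          (hqk x hx)
      exact hsum.congr fun x hx => if_pos hx
    have hgW : ContinuousOn g (T ∩ Wᶜ) :=
      continuousOn_const.congr fun x hx => hg0 x hx.1 hx.2
    have := (hgK.mono (inter_subset_right (s := T))).union_of_isClosed hgW
      (hT.inter hK.isClosed) (hT.inter hW.isClosed_compl)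
    refine this.mono fun x hx => ?_
    by_cases hxW : x ∈ W
    · exact Or.inl ⟨hx, hWK hxW⟩
    · exact Or.inr ⟨hx, hxW⟩
  · have hprod : ∀ k ≤ n + 1, ∃ r : ℝ, 0 < r ∧ u (τ k, x) =
        r * Complex.exp ((∑ i ∈ Finset.range k, (q i x).arg : ℝ) * Complex.I) * u (0, x) := by
      intro k
      induction k with
      | zero => exact fun _ => ⟨1, one_pos, by simp [τ]⟩
      | succ k ih =>
        intro hk
        obtain ⟨r, hr, h⟩ := ih (by omega)
        have hne := hu0 (τ k, x) ⟨hτ k (by omega), hx⟩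
        have hq : q k x ≠ 0 := Complex.slitPlane_ne_zero (hslit k hk x hx)
        refine ⟨‖q k x‖ * r, by positivity, ?_⟩
        have h1 : u (τ (k + 1), x) = q k x * u (τ k, x) := (div_mul_cancel₀ _ hne).symm
        rw [h1, h, Finset.sum_range_succ]
        nth_rewrite 1 [← Complex.norm_mul_exp_arg_mul_I (q k x)]
        push_cast
        rw [add_mul, Complex.exp_add]
        ring
    obtain ⟨r, hr, h⟩ := hprod (n + 1) le_rfl
    refine ⟨r, hr, ?_⟩
    have h1 : τ (n + 1) = 1 := by
      simp only [τ]
      push_cast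
      exact div_self hn0.ne'
    rw [h1] at h
    simpa only [g, if_pos hx] using h

section Blocks

variable {m : ℕ} (Nr : Fin m → ℕ)

theorem blkLo_add_eq_sum (r : Fin m) :
    blkLo Nr r + Nr r = ∑ s ∈ Finset.univ.filter (fun s : Fin m => (s : ℕ) < r + 1), Nr s := by
  have : Finset.univ.filter (fun s : Fin m => (s : ℕ) < r + 1) =
      insert r (Finset.univ.filter fun s => s < r) := by
    ext s
    simp only [Finset.mem_filter, Finset.mem_univ, true_and, Finset.mem_insert, Fin.lt_def,
      Fin.ext_iff]
    omega
  rw [this, Finset.sum_insert (by simp), blkLo, add_comm]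

theorem exists_inBlk {N : ℕ} (hN : N = ∑ r, Nr r) (j : Fin N) : ∃ r, inBlk Nr r j := by
  by_contra! h
  have hle : ∀ k ≤ m, ∑ s ∈ Finset.univ.filter (fun s : Fin m => (s : ℕ) < k), Nr s ≤ j := by
    intro k
    induction k with
    | zero => simp
    | succ k ih =>
      intro hk
      have h1 := blkLo_add_eq_sum Nr ⟨k, hk⟩
      rw [← h1]
      have h2 := h ⟨k, hk⟩
      rw [inBlk, not_and, not_lt] at h2
      exact h2 (ih (by omega))
  have := hle m le_rfl
  rw [Finset.filter_true_of_mem fun s _ => s.2, ← hN] at this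
  omega

theorem inBlk.unique {Nr : Fin m → ℕ} {N : ℕ} {j : Fin N} {r s : Fin m} (hr : inBlk Nr r j)
    (hs : inBlk Nr s j) : r = s := by
  have key : ∀ r s : Fin m, inBlk Nr r j → inBlk Nr s j → ¬ r < s := by
    intro r s hr hs hrs
    have h1 : blkLo Nr r + Nr r ≤ blkLo Nr s := by
      rw [blkLo_add_eq_sum]
      refine Finset.sum_le_sum_of_subset fun t ht => ?_
      simp only [Finset.mem_filter, Finset.mem_univ, true_and, Fin.lt_def] at ht hrs ⊢
      omega
    exact (hr.2.trans_le (h1.trans hs.1)).false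
  exact le_antisymm (not_lt.1 (key s r hs hr)) (not_lt.1 (key r s hr hs))

end Blocks

section Configurations

variable (δ : ℝ) {m : ℕ} (P : Fin m → ℂ) (Nr : Fin m → ℕ) {N : ℕ} (ξ0 : Fin N → ℂ) (M : ℝ)

theorem isOpen_cfgOpen : IsOpen (cfgOpen δ P Nr N M) := by
  simp only [cfgOpen, annU, ofPred_and, ofPred_forall]
  refine IsOpen.inter ?_ ?_
  · refine isOpen_iInter_of_finite fun r => isOpen_iInter_of_finite fun j =>
      isOpen_iInter_of_finite fun _ => ?_
    exact (isOpen_lt (by fun_prop) (by fun_prop)).inter (isOpen_lt (by fun_prop) (by fun_prop))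
  · exact isOpen_iInter_of_finite fun j => isOpen_iInter_of_finite fun k =>
      isOpen_iInter_of_finite fun _ => isOpen_lt (by fun_prop) (by fun_prop)

theorem isOpen_Wset : IsOpen (Wset δ P Nr ξ0 M) :=
  (isOpen_cfgOpen δ P Nr M).connectedComponentIn

theorem isCompact_Kset (hN : N = ∑ r, Nr r) : IsCompact (Kset δ P Nr ξ0 M) := by
  choose b hb using exists_inBlk Nr hN
  have hc : IsCompact (Set.pi univ fun j => closedBall (P (b j)) (2 * δ)) :=
    isCompact_univ_pi fun j => isCompact_closedBall _ _
  refine hc.of_isClosed_subset isClosed_closure (closure_minimal (fun ξ hξ j _ => ?_) hc.isClosed)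
  rw [mem_closedBall, dist_eq_norm]
  exact ((connectedComponentIn_subset _ _ hξ).1 _ j (hb j)).2.le

variable {δ P Nr ξ0 M} in
theorem mem_K0set_of_mem_annU {ξ : Fin N → ℂ} (hK : ξ ∈ Kset δ P Nr ξ0 M)
    (hW : ξ ∉ Wset δ P Nr ξ0 M) (hann : ∀ r j, inBlk Nr r j → ξ j ∈ annU δ (P r)) :
    ξ ∈ K0set δ P Nr ξ0 M := by
  have hle : ∀ j k : Fin N, j ≠ k → M⁻¹ ≤ ‖ξ j - ξ k‖ := fun j k hjk =>
    closure_minimal (t := {η : Fin N → ℂ | M⁻¹ ≤ ‖η j - η k‖})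
      (fun η hη => ((connectedComponentIn_subset _ _ hη).2 j k hjk).le)
      (isClosed_le (by fun_prop) (by fun_prop)) hK
  refine ⟨hK, hle, ?_⟩
  by_contra! hne
  exact hW (closure_connectedComponentIn_inter_subset _ _
    ⟨hK, hann, fun j k hjk => (hle j k hjk).lt_of_ne (hne j k hjk).symm⟩)

end Configurations

/-- every admissible deformation γ ∈ ℱ of K maps some configuration of W
onto a configuration whose components lie on the prescribed rays from the points p_r. -/
theorem deformation_hits_rays (Ω : Set ℂ) (hΩo : IsOpen Ω) (hΩc : IsConnected Ω)
    (hΩb : Bornology.IsBounded Ω) (H : ℂ → ℂ → ℝ) (hH : RegPart Ω H)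
    (Z : Finset ℂ) (hZ : (Z : Set ℂ) ⊆ Ω) (α : ℂ → ℝ) (hα : ∀ p ∈ Z, 0 < α p)
    (N : ℕ) (hN : 1 ≤ N) (θ : ℂ → ℝ) (δ : ℝ) (hδ0 : 0 < δ) (hδπ : δ < π / 2)
    (hcones : ∀ p ∈ Z, ∀ q ∈ Z, p ≠ q → Disjoint (coneAt θ δ p) (coneAt θ δ q))
    (hdist : ∀ p ∈ Z, 2 * δ < Metric.infDist p (frontier Ω))
    (hsepZ : ∀ p ∈ Z, ∀ q ∈ Z, p ≠ q → 4 * δ < ‖p - q‖)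
    (m : ℕ) (hm : 1 ≤ m) (P : Fin m → ℂ) (hPinj : Function.Injective P)
    (hPZ : ∀ r, P r ∈ Z) (Nr : Fin m → ℕ) (hNr1 : ∀ r, 1 ≤ Nr r)
    (hNrα : ∀ r, (Nr r : ℝ) < 1 + α (P r)) (hNsum : N = ∑ r, Nr r)
    (ξ0 : Fin N → ℂ)
    (hξ0 : ∀ r : Fin m, ∀ j : Fin N, inBlk Nr r j →
      ξ0 j = P r + ((3 / 2 * δ : ℝ) : ℂ) *
        Complex.exp (((θ (P r) + ((j : ℕ) + 1) * δ / (N : ℝ) : ℝ) : ℂ) * Complex.I))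
    (M : ℝ) (hM : 0 < M) (hW : ξ0 ∈ Wset δ P Nr ξ0 M)
    (hKD : Kset δ P Nr ξ0 M ⊆ Dset Ω H Z α M) :
    ∀ γ : (Fin N → ℂ) → (Fin N → ℂ), inF Ω H Z α δ P Nr ξ0 M γ →
      ∃ ξγ ∈ Wset δ P Nr ξ0 M, onRays θ δ P Nr (γ ξγ) := by
  rintro γ ⟨-, -, Γ, hΓc, hΓD, hΓ0, hΓ1, hΓfix⟩
  choose b hb using exists_inBlk Nr hNsum
  have hbr : ∀ r j, inBlk Nr r j → r = b j := fun r j h => h.unique (hb j)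
  set K := Kset δ P Nr ξ0 M
  set W := Wset δ P Nr ξ0 M
  let T : Set (Fin N → ℂ) := {ξ | ∀ j, ‖ξ j - P (b j)‖ = 3 / 2 * δ}
  have hT : IsClosed T := by
    simp only [T, ofPred_forall]
    exact isClosed_iInter fun j => isClosed_eq (by fun_prop) continuous_const
  have hTfix : ∀ t ∈ Icc (0 : ℝ) 1, ∀ ξ ∈ K, ξ ∈ T → ξ ∉ W → Γ (t, ξ) = Γ (0, ξ) := by
    intro t ht ξ hξK hξT hξW
    have h0 : ξ ∈ K0set δ P Nr ξ0 M := mem_K0set_of_mem_annU hξK hξW fun r j hj => by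
      rw [hbr r j hj, annU, mem_ofPred_eq, hξT j]
      constructor <;> linarith
    rw [hΓfix t ht ξ h0, hΓ0 ξ hξK]
  have hlift := fun j : Fin N => exists_continuousOn_argument_displacement
    (u := fun z : ℝ × (Fin N → ℂ) => Γ z j - P (b j)) (isCompact_Kset δ P Nr ξ0 M hNsum)
    (isOpen_Wset δ P Nr ξ0 M) hT subset_closure
    (((continuous_apply j).comp_continuousOn hΓc).sub continuousOn_const)
    (fun z hz h => ((hΓD hz).1.1 j).2 (by
      have h : Γ z j - P (b j) = 0 := h
      rw [sub_eq_zero.1 h]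
      exact hPZ (b j)))
    (fun t ht ξ hξK hξT hξW => by simp only [hTfix t ht ξ hξK hξT hξW])
  choose g hgc hg0 hgu using hlift
  let polar : (Fin N → ℝ) → (Fin N → ℂ) := fun x j =>
    P (b j) + ((3 / 2 * δ : ℝ) : ℂ) * Complex.exp ((x j : ℂ) * Complex.I)
  have hpolarT : ∀ x, polar x ∈ T := fun x j => by
    simp only [polar, add_sub_cancel_left]
    rw [norm_mul, Complex.norm_exp_ofReal_mul_I, mul_one, Complex.norm_real]
    exact Real.norm_of_nonneg (by positivity)
  have hpolarc : Continuous polar := by fun_prop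
  let y : Fin N → ℝ := fun j => θ (P (b j)) + ((j : ℕ) + 1) * δ / (N : ℝ)
  have hy : polar y = ξ0 := funext fun j => (hξ0 (b j) j (hb j)).symm
  obtain ⟨x, hx⟩ := exists_add_eq_of_periodic_two_pi (g := fun x j => g j (polar x))
    (fun x n => by
      have : polar (fun i => x i + n i * (2 * π)) = polar x := funext fun j => by
        have e : ((x j + n j * (2 * π) : ℝ) : ℂ) * Complex.I =
            (x j : ℂ) * Complex.I + n j * (2 * π * Complex.I) := by
          push_cast
          ring
        simp only [polar]
        rw [e, Complex.exp_add, Complex.exp_int_mul_two_pi_mul_I, mul_one]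
      simp only [this])
    (continuous_pi fun j => (hgc j).comp_continuous hpolarc hpolarT) y
  have hxj : ∀ j, x j + g j (polar x) = y j := fun j => congrFun hx j
  have hxW : polar x ∈ W := by
    by_contra hxW
    have : x = y := funext fun j => by
      rw [← hxj j, hg0 j _ (hpolarT x) hxW, add_zero]
    rw [this, hy] at hxW
    exact hxW hW
  have hxK : polar x ∈ K := subset_closure hxW
  refine ⟨polar x, hxW, fun r j hj => ?_⟩
  obtain rfl := hbr r j hj
  obtain ⟨ρ, hρ, h⟩ := hgu j _ hxK
  rw [hΓ1 _ hxK, hΓ0 _ hxK] at h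
  have hmain : γ (polar x) j - P (b j) =
      ((ρ * (3 / 2 * δ) : ℝ) : ℂ) * Complex.exp ((y j : ℂ) * Complex.I) := by
    rw [h, ← hxj j]
    simp only [polar, add_sub_cancel_left]
    push_cast
    rw [add_mul, Complex.exp_add]
    ring
  have hnorm : ‖γ (polar x) j - P (b j)‖ = ρ * (3 / 2 * δ) := by
    rw [hmain, norm_mul, Complex.norm_exp_ofReal_mul_I, mul_one, Complex.norm_real]
    exact Real.norm_of_nonneg (by positivity)
  rw [hnorm]
  exact hmain
end
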